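/- arXiv:2507.23467 — 3 statements merged into one kernel-verified Lean document; each statement's English description precedes it below -/
import Mathlib

section
/- Let r > 0 and 0 < α < 1. Let Z be a positive random variable with continuous density on (0,∞) whose Mellin transform exists for Re(z) > 1-r. If Z has the same distribution as Z^α · Y_{α,r}, where Y_{α,r} is independent of Z with density t^(r-1) W_{-α,r(1-α)}(-t), then Z is gamma distributed with shape parameter r. -/
open MeasureTheory Set

/-- The Wright function `W_{λ,μ}`. -/
noncomputable def wright (lam mu z : ℝ) : ℝ :=
  ∑' l : ℕ, z ^ l / (l.factorial * Real.Gamma (lam * l + mu))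


lemma gc_slit {ω : ℂ} (him : ω.im ≠ 0) {a x : ℝ} (_ : 0 ≤ a) (hx : 0 ≤ x) (h : 0 < a ∨ 0 < x) :
    (a : ℂ) + x * ω ∈ Complex.slitPlane := by
  rw [Complex.mem_slitPlane_iff]
  rcases hx.eq_or_lt with h0 | h0
  · left; subst h0; simpa using h
  · right; simp; exact ⟨h0.ne', him⟩

lemma gc_norm_le {ω : ℂ} (hn : ‖ω‖ = 1) {a x : ℝ} (ha : 0 ≤ a) (ha1 : a ≤ 1) (hx : 0 ≤ x) :
    ‖(a : ℂ) + x * ω‖ ≤ 1 + x := by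
  calc _ ≤ ‖(a:ℂ)‖ + ‖(x:ℂ) * ω‖ := norm_add_le _ _
    _ = a + x := by simp [hn, abs_of_nonneg ha, abs_of_nonneg hx]
    _ ≤ _ := by linarith

lemma gc_norm_ge {ω : ℂ} (hn : ‖ω‖ = 1) (x : ℝ) :
    |ω.im| ≤ ‖(1 : ℂ) + x * ω‖ := by
  have h1 : ω.re ^ 2 + ω.im ^ 2 = 1 := by
    have := Complex.sq_norm ω
    rw [hn, Complex.normSq_apply] at this; nlinarith
  have h2 : ‖(1 : ℂ) + x * ω‖ ^ 2 = (1 + x * ω.re) ^ 2 + (x * ω.im) ^ 2 := by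
    rw [Complex.sq_norm, Complex.normSq_apply]; simp; ring
  apply abs_le_of_sq_le_sq _ (norm_nonneg _)
  rw [h2]
  nlinarith [sq_nonneg (x + ω.re)]

lemma gc_log {ω : ℂ} (hn : ‖ω‖ = 1) (him : ω.im ≠ 0) :
    ∃ C : ℝ, 0 ≤ C ∧ ∀ x : ℝ, 0 ≤ x → ‖Complex.log (1 + x * ω)‖ ≤ C + Real.log (1 + x) := by
  have hle : |ω.im| ≤ 1 := hn ▸ Complex.abs_im_le_norm ω
  have hp : 0 < |ω.im| := abs_pos.2 him
  have hl : Real.log |ω.im| ≤ 0 := Real.log_nonpos hp.le hle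
  refine ⟨Real.pi - Real.log |ω.im|, by linarith [Real.pi_pos], fun x hx => ?_⟩
  have hu := gc_norm_le hn zero_le_one le_rfl hx
  have hge := gc_norm_ge hn x
  simp only [Complex.ofReal_one] at hu
  have h1 : Real.log ‖(1:ℂ) + x * ω‖ ≤ Real.log (1 + x) := Real.log_le_log (hp.trans_le hge) hu
  have h2 : Real.log |ω.im| ≤ Real.log ‖(1:ℂ) + x * ω‖ := Real.log_le_log hp hge
  have h3 : 0 ≤ Real.log (1 + x) := Real.log_nonneg (by linarith)
  calc _ ≤ |(Complex.log (1 + x * ω)).re| + |(Complex.log (1 + x * ω)).im| := Complex.norm_le_abs_re_add_abs_im _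
    _ ≤ (Real.log (1 + x) - Real.log |ω.im|) + Real.pi := by
      gcongr
      · rw [Complex.log_re, abs_le]; constructor <;> linarith
      · rw [Complex.log_im]; exact Complex.abs_arg_le_pi _
    _ = _ := by ring

lemma gc_cpow {ω : ℂ} (hn : ‖ω‖ = 1) (him : ω.im ≠ 0) :
    ∃ C : ℝ, 0 ≤ C ∧ ∀ x : ℝ, 0 ≤ x → ∀ w : ℂ, ∀ K : ℝ, ‖w‖ ≤ K →
      ‖(1 + x * ω : ℂ) ^ w‖ ≤ Real.exp (K * C + K * Real.log (1 + x)) := by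
  obtain ⟨C, hC, h⟩ := gc_log hn him
  refine ⟨C, hC, fun x hx w K hK => ?_⟩
  have hs := gc_slit him zero_le_one hx (Or.inl one_pos)
  simp only [Complex.ofReal_one] at hs
  rw [Complex.cpow_def_of_ne_zero (Complex.slitPlane_ne_zero hs), Complex.norm_exp]
  apply Real.exp_le_exp.2
  calc _ ≤ ‖Complex.log (1 + x * ω) * w‖ := Complex.re_le_norm _
    _ ≤ (C + Real.log (1+x)) * K := by
      rw [norm_mul]
      have := h x hx
      have : 0 ≤ Real.log (1 + x) := Real.log_nonneg (by linarith)
      gcongr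
    _ = _ := by ring

lemma gc_young {α : ℝ} (hα0 : 0 < α) (hα1 : α < 1) (T ε : ℝ) (hε : 0 < ε) :
    ∃ C : ℝ, ∀ y : ℝ, 0 < y → T * y ^ α ≤ ε * y + C := by
  have h : (fun y : ℝ => T * y ^ α) =o[Filter.atTop] (fun y : ℝ => y) := by
    apply Asymptotics.IsLittleO.const_mul_left
    rw [Asymptotics.isLittleO_iff_tendsto' (by
      filter_upwards [Filter.eventually_gt_atTop 0] with y hy h0
      exact absurd h0 hy.ne')]
    refine (tendsto_rpow_neg_atTop (y := 1 - α) (by linarith)).congr' ?_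
    filter_upwards [Filter.eventually_gt_atTop 0] with y hy
    rw [neg_sub, Real.rpow_sub_one hy.ne']
  have h2 := h.def hε
  obtain ⟨N, hN⟩ := Filter.eventually_atTop.1 h2
  refine ⟨|T| * (max N 0) ^ α, fun y hy => ?_⟩
  have hc : 0 ≤ |T| * (max N 0) ^ α := by positivity
  rcases le_total N y with h3 | h3
  · have := hN y h3
    rw [Real.norm_eq_abs, Real.norm_eq_abs, abs_of_pos hy] at this
    linarith [le_abs_self (T * y ^ α)]
  · calc T * y ^ α ≤ |T| * (max N 0) ^ α := by
          gcongr
          · exact le_abs_self T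
          · exact h3.trans (le_max_left _ _)
      _ ≤ _ := by nlinarith

lemma gc_master {α : ℝ} (hα0 : 0 < α) (hα1 : α < 1) {c : ℝ} (hc : c < 0) (A K T : ℝ) (hK : 0 ≤ K) :
    IntegrableOn (fun x : ℝ => Real.exp (c * x + (A + K * Real.log (1 + x)) + T * (1 + x) ^ α)) (Ioi 0) := by
  obtain ⟨C, hC⟩ := gc_young hα0 hα1 (T + K / α) (-c / 2) (by linarith)
  apply integrable_of_isBigO_exp_neg (b := -c / 2) (by linarith)
  · apply ContinuousOn.rexp
    have h : ∀ x ∈ Ici (0:ℝ), 1 + x ≠ 0 := fun x hx => by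
      have : (0:ℝ) ≤ x := hx
      positivity
    apply ContinuousOn.add
    · apply ContinuousOn.add (by fun_prop)
      apply ContinuousOn.add (by fun_prop)
      exact continuousOn_const.mul (ContinuousOn.log (by fun_prop) h)
    · exact continuousOn_const.mul (ContinuousOn.rpow_const (by fun_prop) fun x hx => Or.inl (h x hx))
  · apply Asymptotics.IsBigO.of_bound (Real.exp (A + C + (-c / 2)))
    filter_upwards [Filter.eventually_ge_atTop 0] with x hx
    rw [Real.norm_eq_abs, Real.norm_eq_abs, Real.abs_exp, Real.abs_exp, ← Real.exp_add, Real.exp_le_exp]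
    have h1 : Real.log (1 + x) ≤ (1 + x) ^ α / α := Real.log_le_rpow_div (by linarith) hα0
    have h2 := hC (1 + x) (by linarith)
    have h3 : K * Real.log (1 + x) ≤ K * ((1 + x) ^ α / α) := by gcongr
    have h4 : (T + K / α) * (1 + x) ^ α = T * (1 + x) ^ α + K * ((1 + x) ^ α / α) := by ring
    linarith

lemma gc_norm_exp {ω : ℂ} (a x : ℝ) : ‖Complex.exp (a + x * ω)‖ = Real.exp (a + ω.re * x) := by
  rw [Complex.norm_exp]; simp; ring

/-- one branch of the Hankel integral -/
noncomputable def gcJ (ω z : ℂ) : ℂ := ∫ x in Ioi (0:ℝ), Complex.exp (1 + x * ω) * (1 + x * ω) ^ (-z) * ω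

lemma gc_J_bound {ω : ℂ} (hn : ‖ω‖ = 1) (him : ω.im ≠ 0) (hre : ω.re < 0) (K : ℝ) (hK : 0 ≤ K) :
    ∃ B : ℝ → ℝ, IntegrableOn B (Ioi 0) ∧ ∀ x : ℝ, 0 ≤ x → ∀ z : ℂ, ‖z‖ ≤ K →
      ‖Complex.exp (1 + x * ω) * (1 + x * ω) ^ (-z) * ω‖ ≤ B x := by
  obtain ⟨C, hC, h⟩ := gc_cpow hn him
  refine ⟨_, gc_master (α := 1/2) (by norm_num) (by norm_num) hre (1 + K * C) K 0 hK, fun x hx z hz => ?_⟩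
  rw [norm_mul, norm_mul, hn, mul_one]
  have := gc_norm_exp (ω := ω) 1 x
  rw [Complex.ofReal_one] at this
  rw [this]
  have h2 := h x hx (-z) K (by simpa using hz)
  calc _ ≤ Real.exp (1 + ω.re * x) * Real.exp (K * C + K * Real.log (1 + x)) := by gcongr
    _ = _ := by rw [← Real.exp_add]; congr 1; ring

lemma gc_J_integrable {ω : ℂ} (hn : ‖ω‖ = 1) (him : ω.im ≠ 0) (hre : ω.re < 0) (z : ℂ) :
    IntegrableOn (fun x : ℝ => Complex.exp (1 + x * ω) * (1 + x * ω) ^ (-z) * ω) (Ioi 0) := by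
  obtain ⟨B, hB, h⟩ := gc_J_bound hn him hre ‖z‖ (norm_nonneg _)
  apply Integrable.mono' hB
  · exact Measurable.aestronglyMeasurable (by fun_prop)
  · filter_upwards [ae_restrict_mem measurableSet_Ioi] with x hx
    exact h x (le_of_lt hx) z le_rfl

lemma gc_J_cont {ω : ℂ} (hn : ‖ω‖ = 1) (him : ω.im ≠ 0) (hre : ω.re < 0) :
    Continuous (gcJ ω) := by
  rw [continuous_iff_continuousAt]
  intro z0
  obtain ⟨B, hB, h⟩ := gc_J_bound hn him hre (‖z0‖ + 1) (by positivity)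
  apply continuousAt_of_dominated (bound := B)
  · exact Filter.Eventually.of_forall fun z => Measurable.aestronglyMeasurable (by fun_prop)
  · filter_upwards [(continuous_norm.tendsto z0).eventually_le_const (show ‖z0‖ < ‖z0‖ + 1 by linarith)] with z hz
    filter_upwards [ae_restrict_mem measurableSet_Ioi] with x hx
    exact h x (le_of_lt hx) z hz
  · exact hB
  · filter_upwards [ae_restrict_mem measurableSet_Ioi] with x hx
    have hs := gc_slit him zero_le_one (le_of_lt hx) (Or.inl one_pos)
    simp only [Complex.ofReal_one] at hs
    apply ContinuousAt.mul _ continuousAt_const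
    apply ContinuousAt.mul continuousAt_const
    exact ContinuousAt.const_cpow continuousAt_neg (Or.inl (Complex.slitPlane_ne_zero hs))

lemma gc_F_deriv {ω : ℂ} (z : ℂ) (a x : ℝ) (h : (a:ℂ) + x * ω ∈ Complex.slitPlane) :
    HasDerivAt (fun x : ℝ => Complex.exp (a + x * ω) * (a + x * ω) ^ (-z))
      (Complex.exp (a + x * ω) * (a + x * ω) ^ (-z) * ω
        - z * (Complex.exp (a + x * ω) * (a + x * ω) ^ (-(z + 1)) * ω)) x := by
  have h1 : HasDerivAt (fun x : ℂ => (a:ℂ) + x * ω) ω x := by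
    simpa using ((hasDerivAt_id (x:ℂ)).mul_const ω).const_add (a:ℂ)
  have h2 := (h1.cexp.mul (h1.cpow_const (c := -z) h)).comp_ofReal
  refine h2.congr_deriv ?_
  rw [show -(z+1) = -z - 1 by ring]; ring

lemma gc_F_deriv' {ω : ℂ} (z : ℂ) (a x : ℝ) (h : (a:ℂ) + x * ω ∈ Complex.slitPlane) :
    HasDerivAt (fun a : ℝ => Complex.exp (a + x * ω) * (a + x * ω) ^ (-z))
      (Complex.exp (a + x * ω) * (a + x * ω) ^ (-z)
        - z * (Complex.exp (a + x * ω) * (a + x * ω) ^ (-(z + 1)))) a := by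
  have h1 : HasDerivAt (fun a : ℂ => (a:ℂ) + x * ω) 1 a := by
    simpa using (hasDerivAt_id (a:ℂ)).add_const (x * ω:ℂ)
  have h2 := (h1.cexp.mul (h1.cpow_const (c := -z) h)).comp_ofReal
  refine h2.congr_deriv ?_
  rw [show -(z+1) = -z - 1 by ring]; ring

lemma gc_gamma_meas (a c : ℂ) (s : Set ℝ) :
    AEStronglyMeasurable (fun t : ℝ => (t : ℂ) ^ a * Complex.exp (-(c * t))) (volume.restrict s) :=
  Measurable.aestronglyMeasurable (by fun_prop)

lemma gc_gamma_norm (a c : ℂ) {t : ℝ} (ht : 0 < t) :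
    ‖(t : ℂ) ^ a * Complex.exp (-(c * t))‖ = t ^ a.re * Real.exp (-c.re * t) := by
  rw [norm_mul, Complex.norm_cpow_eq_rpow_re_of_pos ht, Complex.norm_exp]
  simp

lemma gc_rpow_exp_int {s b : ℝ} (hs : -1 < s) (hb : 0 < b) :
    IntegrableOn (fun t : ℝ => t ^ s * Real.exp (-b * t)) (Ioi 0) := by
  simpa using integrableOn_rpow_mul_exp_neg_mul_rpow hs one_pos hb

lemma gc_gamma_int {a c : ℂ} (ha : -1 < a.re) (hc : 0 < c.re) :
    IntegrableOn (fun t : ℝ => (t : ℂ) ^ a * Complex.exp (-(c * t))) (Ioi 0) := by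
  apply Integrable.mono' (gc_rpow_exp_int ha hc) (gc_gamma_meas _ _ _)
  filter_upwards [ae_restrict_mem measurableSet_Ioi] with t ht
  exact (gc_gamma_norm a c ht).le

lemma gc_gamma_deriv {a c : ℂ} (ha : -1 < a.re) (hc : 0 < c.re) :
    DifferentiableAt ℂ (fun c : ℂ => ∫ t in Ioi (0:ℝ), (t : ℂ) ^ a * Complex.exp (-(c * t))) c := by
  have hs : {w : ℂ | c.re / 2 < w.re} ∈ nhds c :=
    (isOpen_lt continuous_const Complex.continuous_re).mem_nhds (by simpa using hc)
  have h := hasDerivAt_integral_of_dominated_loc_of_deriv_le (𝕜 := ℂ) (μ := volume.restrict (Ioi (0:ℝ)))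
    (F := fun (c : ℂ) (t : ℝ) => (t : ℂ) ^ a * Complex.exp (-(c * t)))
    (F' := fun (c : ℂ) (t : ℝ) => (t : ℂ) ^ a * (Complex.exp (-(c * t)) * (-t)))
    (bound := fun t => t ^ (a.re + 1) * Real.exp (-(c.re / 2) * t))
    hs (Filter.Eventually.of_forall fun c => gc_gamma_meas _ _ _) (gc_gamma_int ha hc)
    (Measurable.aestronglyMeasurable (by fun_prop)) ?_ (gc_rpow_exp_int (by linarith) (by linarith)) ?_
  · exact h.2.differentiableAt
  · filter_upwards [ae_restrict_mem measurableSet_Ioi] with t ht w hw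
    have ht' : (0:ℝ) < t := ht
    have hw' : c.re / 2 < w.re := hw
    rw [← mul_assoc, norm_mul, gc_gamma_norm a w ht, Real.rpow_add ht', Real.rpow_one, norm_neg,
      Complex.norm_real, Real.norm_eq_abs, abs_of_pos ht']
    calc _ = t ^ a.re * t * Real.exp (-w.re * t) := by ring
      _ ≤ _ := by
        gcongr
  · filter_upwards [ae_restrict_mem measurableSet_Ioi] with t ht w hw
    apply HasDerivAt.const_mul
    have : HasDerivAt (fun c : ℂ => -(c * (t:ℂ))) (-t) w := by
      exact ((hasDerivAt_id w).mul_const (t:ℂ)).neg.congr_deriv (by simp)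
    exact this.cexp

lemma gc_gamma {a c : ℂ} (ha : 0 < a.re) (hc : 0 < c.re) :
    ∫ t in Ioi (0:ℝ), (t : ℂ) ^ (a - 1) * Complex.exp (-(c * t)) = c ^ (-a) * Complex.Gamma a := by
  have hU : IsOpen {w : ℂ | 0 < w.re} := isOpen_lt continuous_const Complex.continuous_re
  have hf : AnalyticOnNhd ℂ (fun c : ℂ => ∫ t in Ioi (0:ℝ), (t : ℂ) ^ (a - 1) * Complex.exp (-(c * t)))
      {w : ℂ | 0 < w.re} := DifferentiableOn.analyticOnNhd (fun w hw =>
        (gc_gamma_deriv (by simpa using ha) hw).differentiableWithinAt) hU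
  have hg : AnalyticOnNhd ℂ (fun c : ℂ => c ^ (-a) * Complex.Gamma a)
      {w : ℂ | 0 < w.re} := DifferentiableOn.analyticOnNhd (fun w hw => by
        apply DifferentiableAt.differentiableWithinAt
        apply DifferentiableAt.mul_const
        exact differentiableAt_id.cpow_const (Or.inl hw)) hU
  have hconv : IsPreconnected {w : ℂ | 0 < w.re} :=
    (convex_halfSpace_re_gt 0).isPreconnected
  refine hf.eqOn_of_preconnected_of_frequently_eq hg hconv (z₀ := 1) (by simp) ?_ hc
  have hev : ∀ᶠ x : ℝ in nhdsWithin 1 {1}ᶜ, (∫ t in Ioi (0:ℝ), (t : ℂ) ^ (a - 1) * Complex.exp (-((x:ℂ) * t)))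
      = (x:ℂ) ^ (-a) * Complex.Gamma a := by
    filter_upwards [mem_nhdsWithin_of_mem_nhds (Ioi_mem_nhds (show (0:ℝ) < 1 by norm_num))] with x hx
    have hx' : (0:ℝ) < x := hx
    rw [Complex.integral_cpow_mul_exp_neg_mul_Ioi ha hx', one_div, Complex.inv_cpow _ _ (by
      rw [Complex.arg_ofReal_of_nonneg hx'.le]; exact Real.pi_pos.ne), Complex.cpow_neg]
  have htend : Filter.Tendsto (fun x : ℝ => (x:ℂ)) (nhdsWithin 1 {1}ᶜ) (nhdsWithin 1 {1}ᶜ) := by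
    apply tendsto_nhdsWithin_of_tendsto_nhds_of_eventually_within
    · exact (Complex.continuous_ofReal.tendsto' 1 1 (by simp)).mono_left nhdsWithin_le_nhds
    · filter_upwards [self_mem_nhdsWithin] with x hx
      simpa using hx
  exact htend.frequently hev.frequently

/-- integral of the derivative along a ray -/
lemma gc_ray {ω : ℂ} (him : ω.im ≠ 0) (z : ℂ) {a : ℝ} (ha : 0 < a)
    (h0 : IntegrableOn (fun x : ℝ => Complex.exp (a + x * ω) * (a + x * ω) ^ (-z) * ω) (Ioi 0))
    (h1 : IntegrableOn (fun x : ℝ => Complex.exp (a + x * ω) * (a + x * ω) ^ (-(z+1)) * ω) (Ioi 0)) :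
    ∫ x in Ioi (0:ℝ), (Complex.exp (a + x * ω) * (a + x * ω) ^ (-z) * ω
        - z * (Complex.exp (a + x * ω) * (a + x * ω) ^ (-(z + 1)) * ω)) = - (Complex.exp a * (a:ℂ) ^ (-z)) := by
  have hω : ω ≠ 0 := fun h => him (by simp [h])
  have hd : ∀ x : ℝ, 0 ≤ x → _ := fun x hx => gc_F_deriv z a x (gc_slit him ha.le hx (Or.inl ha))
  have hi := h0.sub (h1.const_mul z)
  have h0' : IntegrableOn (fun x : ℝ => Complex.exp (a + x * ω) * (a + x * ω) ^ (-z)) (Ioi 0) := by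
    refine (h0.mul_const ω⁻¹).congr (Filter.Eventually.of_forall fun x => ?_)
    field_simp
  have := integral_Ioi_of_hasDerivAt_of_tendsto (a := 0)
    (hd 0 le_rfl).continuousAt.continuousWithinAt (fun x hx => hd x (le_of_lt hx)) hi
    (tendsto_zero_of_hasDerivAt_of_integrableOn_Ioi (fun x hx => hd x (le_of_lt hx)) hi h0')
  rw [this]; simp

lemma gc_J_rec {ω : ℂ} (hn : ‖ω‖ = 1) (him : ω.im ≠ 0) (hre : ω.re < 0) (z : ℂ) :
    gcJ ω z - z * gcJ ω (z + 1) = - Complex.exp 1 := by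
  have h0 := gc_J_integrable hn him hre z
  have h1 := gc_J_integrable hn him hre (z+1)
  have := gc_ray him z one_pos (by simpa using h0) (by simpa using h1)
  simp only [Complex.ofReal_one] at this
  rw [integral_sub h0 (h1.const_mul z), integral_const_mul] at this
  simpa [gcJ] using this

lemma gc_sector_bound {ω : ℂ} (hn : ‖ω‖ = 1) {w : ℂ} (hw : 0 ≤ w.re) {a x : ℝ} (ha : 0 ≤ a) (ha1 : a ≤ 1)
    (hx : 0 ≤ x) : ‖Complex.exp (a + x * ω) * (a + x * ω) ^ w * ω‖ ≤
      Real.exp (ω.re * x + ((1 + Real.pi * |w.im|) + w.re * Real.log (1 + x)) + 0 * (1 + x) ^ (1/2:ℝ)) := by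
  rw [norm_mul, norm_mul, hn, mul_one, gc_norm_exp]
  have h1 : ‖(a + x * ω : ℂ) ^ w‖ ≤ Real.exp (Real.pi * |w.im| + w.re * Real.log (1 + x)) := by
    refine (Complex.norm_cpow_le _ _).trans ?_
    rw [div_eq_mul_inv, ← Real.exp_neg, Real.exp_add, mul_comm]
    gcongr
    · calc _ ≤ |Complex.arg (a + x * ω) * w.im| := neg_le_abs _
        _ ≤ _ := by rw [abs_mul]; gcongr; exact Complex.abs_arg_le_pi _
    · rw [mul_comm w.re, Real.exp_mul, Real.exp_log (by linarith)]
      gcongr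
      exact gc_norm_le hn ha ha1 hx
  calc _ ≤ Real.exp (1 + ω.re * x) * Real.exp (Real.pi * |w.im| + w.re * Real.log (1 + x)) := by gcongr
    _ = _ := by rw [← Real.exp_add]; congr 1; ring

lemma gc_sector_B {ω : ℂ} (hre : ω.re < 0) {w : ℂ} (hw : 0 ≤ w.re) :
    IntegrableOn (fun x : ℝ => Real.exp (ω.re * x + ((1 + Real.pi * |w.im|) + w.re * Real.log (1 + x)) + 0 * (1 + x) ^ (1/2:ℝ))) (Ioi 0) :=
  gc_master (by norm_num) (by norm_num) hre _ _ _ hw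

lemma gc_sector_int {ω : ℂ} (hn : ‖ω‖ = 1) (hre : ω.re < 0) {w : ℂ} (hw : 0 ≤ w.re) {a : ℝ} (ha : 0 ≤ a) (ha1 : a ≤ 1) :
    IntegrableOn (fun x : ℝ => Complex.exp (a + x * ω) * (a + x * ω) ^ w * ω) (Ioi 0) := by
  apply Integrable.mono' (gc_sector_B hre hw)
  · exact Measurable.aestronglyMeasurable (by fun_prop)
  · filter_upwards [ae_restrict_mem measurableSet_Ioi] with x hx
    exact gc_sector_bound hn hw ha ha1 (le_of_lt hx)

lemma gc_sector_int2 {ω : ℂ} (hn : ‖ω‖ = 1) (hre : ω.re < 0) {w : ℂ} (hw : 0 ≤ w.re) :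
    Integrable (Function.uncurry fun (x a : ℝ) => Complex.exp (a + x * ω) * (a + x * ω) ^ w * ω)
     ((volume.restrict (Ioi 0)).prod (volume.restrict (Ioc 0 1))) := by
  have h1 : Integrable (fun _ : ℝ => (1:ℝ)) (volume.restrict (Ioc (0:ℝ) 1)) := integrable_const _
  have := Integrable.mul_prod (gc_sector_B hre hw) h1
  apply Integrable.mono' this
  · exact Measurable.aestronglyMeasurable (by unfold Function.uncurry; fun_prop)
  · rw [Measure.prod_restrict]
    filter_upwards [ae_restrict_mem (measurableSet_Ioi.prod measurableSet_Ioc)] with p hp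
    have := gc_sector_bound hn hw (le_of_lt hp.2.1) hp.2.2 (le_of_lt hp.1)
    simpa [Function.uncurry] using this

lemma gc_J_shift {ω : ℂ} (hn : ‖ω‖ = 1) (him : ω.im ≠ 0) (hre : ω.re < 0) {z : ℂ} (hz : z.re ≤ -2) :
    gcJ ω z = (∫ x in Ioi (0:ℝ), Complex.exp (x * ω) * (x * ω) ^ (-z) * ω)
      - ∫ b in (0:ℝ)..1, Complex.exp b * (b:ℂ) ^ (-z) := by
  have hw : 0 ≤ (-z).re := by simp; linarith
  have hw1 : 0 ≤ (-(z+1)).re := by simp; linarith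
  set G : ℝ → ℝ → ℂ := fun x a => Complex.exp (a + x * ω) * (a + x * ω) ^ (-z) * ω
        - z * (Complex.exp (a + x * ω) * (a + x * ω) ^ (-(z + 1)) * ω) with hG
  have hGint : Integrable (Function.uncurry G)
     ((volume.restrict (Ioi 0)).prod (volume.restrict (Ioc 0 1))) :=
    (gc_sector_int2 hn hre hw).sub ((gc_sector_int2 hn hre hw1).const_mul z)
  have hswap := integral_integral_swap hGint
  have hl : ∀ x ∈ Ioi (0:ℝ), ∫ a in Ioc (0:ℝ) 1, G x a =
      Complex.exp (1 + x * ω) * (1 + x * ω) ^ (-z) * ω - Complex.exp (x * ω) * (x * ω) ^ (-z) * ω := by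
    intro x hx
    rw [← intervalIntegral.integral_of_le zero_le_one]
    have hs : ∀ a ∈ uIcc (0:ℝ) 1, (a:ℂ) + x * ω ∈ Complex.slitPlane := by
      intro a ha
      rw [uIcc_of_le zero_le_one] at ha
      exact gc_slit him ha.1 (le_of_lt hx) (Or.inr hx)
    have hd : ∀ a ∈ uIcc (0:ℝ) 1, HasDerivAt (fun a : ℝ => Complex.exp (a + x * ω) * (a + x * ω) ^ (-z) * ω) (G x a) a := by
      intro a ha
      refine ((gc_F_deriv' z a x (hs a ha)).mul_const ω).congr_deriv ?_
      rw [hG]; ring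
    have hc : ∀ w : ℂ, ContinuousOn (fun a : ℝ => Complex.exp (a + x * ω) * (a + x * ω) ^ w * ω) (uIcc (0:ℝ) 1) := by
      intro w
      apply ContinuousOn.mul _ continuousOn_const
      apply ContinuousOn.mul (by fun_prop)
      apply ContinuousOn.cpow_const (by fun_prop) hs
    rw [intervalIntegral.integral_eq_sub_of_hasDerivAt hd
      (ContinuousOn.intervalIntegrable ((hc _).sub (continuousOn_const.mul (hc _))))]
    simp
  have hr : ∀ a ∈ Ioc (0:ℝ) 1, ∫ x in Ioi (0:ℝ), G x a = - (Complex.exp a * (a:ℂ) ^ (-z)) := by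
    intro a ha
    exact gc_ray him z ha.1 (gc_sector_int hn hre hw ha.1.le ha.2) (gc_sector_int hn hre hw1 ha.1.le ha.2)
  rw [setIntegral_congr_fun measurableSet_Ioi hl, setIntegral_congr_fun measurableSet_Ioc hr, integral_sub
    (gc_J_integrable hn him hre z) (by simpa [IntegrableOn] using gc_sector_int hn hre hw le_rfl zero_le_one), integral_neg,
    ← intervalIntegral.integral_of_le zero_le_one] at hswap
  rw [gcJ]
  linear_combination hswap

lemma gc_ray0 {ω : ℂ} (him : ω.im ≠ 0) (hre : ω.re < 0) {z : ℂ} (hz : z.re ≤ -2) :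
    (∫ x in Ioi (0:ℝ), Complex.exp (x * ω) * (x * ω) ^ (-z) * ω) =
      Complex.exp ((Complex.log ω - Complex.log (-ω)) * (1 - z)) * Complex.Gamma (1 - z) := by
  have hω : ω ≠ 0 := fun h => him (by simp [h])
  have h1 := gc_gamma (a := 1 - z) (c := -ω) (by simp; linarith) (by simpa using hre)
  have h2 : ∀ x ∈ Ioi (0:ℝ), Complex.exp (x * ω) * (x * ω) ^ (-z) * ω =
      ω ^ (1 - z) * ((x:ℂ) ^ (1 - z - 1) * Complex.exp (-(-ω * x))) := by
    intro x hx
    have hx' : (0:ℝ) < x := hx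
    have hxc : (x:ℂ) ≠ 0 := Complex.ofReal_ne_zero.2 hx'.ne'
    rw [Complex.cpow_def_of_ne_zero (mul_ne_zero hxc hω), Complex.cpow_def_of_ne_zero hω,
      Complex.cpow_def_of_ne_zero hxc, Complex.log_ofReal_mul hx' hω, Complex.ofReal_log hx'.le]
    nth_rewrite 3 [← Complex.exp_log hω]
    rw [← Complex.exp_add, ← Complex.exp_add, ← Complex.exp_add, ← Complex.exp_add]
    congr 1; ring
  rw [setIntegral_congr_fun measurableSet_Ioi h2, integral_const_mul, h1,
    Complex.cpow_def_of_ne_zero hω, Complex.cpow_def_of_ne_zero (neg_ne_zero.2 hω), ← mul_assoc, ← Complex.exp_add]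
  congr 2; ring

lemma gc_hankel_base {ω : ℂ} (hn : ‖ω‖ = 1) (him : 0 < ω.im) (hre : ω.re < 0) {z : ℂ} (hz : z.re ≤ -2) :
    gcJ ω z - gcJ (starRingEnd ℂ ω) z = 2 * Real.pi * Complex.I * (Complex.Gamma z)⁻¹ := by
  have hn' : ‖starRingEnd ℂ ω‖ = 1 := by simpa using hn
  have him' : (starRingEnd ℂ ω).im < 0 := by simpa using him
  have hre' : (starRingEnd ℂ ω).re < 0 := by simpa using hre
  rw [gc_J_shift hn him.ne' hre hz, gc_J_shift hn' him'.ne hre' hz, gc_ray0 him.ne' hre hz, gc_ray0 him'.ne hre' hz]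
  have e1 : Complex.log ω - Complex.log (-ω) = Real.pi * Complex.I := by
    apply Complex.ext
    · simp [Complex.log_re]
    · simp [Complex.log_im, Complex.arg_neg_eq_arg_sub_pi_of_im_pos him]
  have e2 : Complex.log (starRingEnd ℂ ω) - Complex.log (-(starRingEnd ℂ ω)) = -(Real.pi * Complex.I) := by
    apply Complex.ext
    · simp [Complex.log_re]
    · simp only [Complex.sub_im, Complex.log_im, Complex.arg_neg_eq_arg_add_pi_of_im_neg him']; simp
  rw [e1, e2]
  have hs : Complex.exp (Real.pi * Complex.I * (1 - z)) - Complex.exp (-(Real.pi * Complex.I) * (1 - z))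
      = 2 * Complex.I * Complex.sin (Real.pi * z) := by
    have : Complex.sin (Real.pi * z) = Complex.sin (Real.pi * (1 - z)) := by
      rw [mul_sub, mul_one, Complex.sin_pi_sub]
    rw [this, Complex.sin]
    have hI := Complex.I_mul_I
    have a1 : Real.pi * Complex.I * (1 - z) = Real.pi * (1 - z) * Complex.I := by ring
    have a2 : -(Real.pi * Complex.I) * (1 - z) = -(Real.pi * (1 - z)) * Complex.I := by ring
    rw [a1, a2]
    linear_combination (-(Complex.exp (-(Real.pi * (1 - z)) * Complex.I) - Complex.exp (Real.pi * (1 - z) * Complex.I))) * hI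
  have hg := Complex.Gamma_mul_Gamma_one_sub z
  have hg1 : Complex.Gamma (1 - z) ≠ 0 := Complex.Gamma_ne_zero_of_re_pos (by simp; linarith)
  have key : Complex.sin (Real.pi * z) * Complex.Gamma (1 - z) = Real.pi * (Complex.Gamma z)⁻¹ := by
    by_cases h0 : Complex.sin (Real.pi * z) = 0
    · rw [h0, div_zero] at hg
      have : Complex.Gamma z = 0 := by simpa [hg1] using hg
      simp [h0, this]
    · have hpi : (Real.pi : ℂ) ≠ 0 := Complex.ofReal_ne_zero.2 Real.pi_ne_zero
      have hgz : Complex.Gamma z ≠ 0 := by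
        intro h; rw [h, zero_mul] at hg
        exact div_ne_zero hpi h0 hg.symm
      rw [eq_div_iff h0] at hg
      field_simp
      linear_combination hg
  linear_combination Complex.Gamma (1 - z) * hs + 2 * Complex.I * key

lemma gc_hankel {ω : ℂ} (hn : ‖ω‖ = 1) (him : 0 < ω.im) (hre : ω.re < 0) (z : ℂ) :
    gcJ ω z - gcJ (starRingEnd ℂ ω) z = 2 * Real.pi * Complex.I * (Complex.Gamma z)⁻¹ := by
  have hn' : ‖starRingEnd ℂ ω‖ = 1 := by simpa using hn
  have him' : (starRingEnd ℂ ω).im < 0 := by simpa using him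
  have hre' : (starRingEnd ℂ ω).re < 0 := by simpa using hre
  have hP : ∀ n : ℕ, ∀ z : ℂ, z.im ≠ 0 → z.re ≤ n - 2 →
      gcJ ω z - gcJ (starRingEnd ℂ ω) z = 2 * Real.pi * Complex.I * (Complex.Gamma z)⁻¹ := by
    intro n
    induction n with
    | zero => intro z _ hz; exact gc_hankel_base hn him hre (by simpa using hz)
    | succ n ih =>
      intro z h0 hz
      have := ih (z - 1) (by simpa using h0) (by simp at hz ⊢; linarith)
      have r1 := gc_J_rec hn him.ne' hre (z - 1)
      have r2 := gc_J_rec hn' him'.ne hre' (z - 1)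
      have hne : z - 1 ≠ 0 := by
        intro h; apply h0
        have := congrArg Complex.im h
        simpa using this
      have hG := Complex.one_div_Gamma_eq_self_mul_one_div_Gamma_add_one (z - 1)
      rw [sub_add_cancel] at r1 r2 hG
      rw [hG] at this
      apply mul_left_cancel₀ hne
      linear_combination this - r1 + r2
  have hd : Dense {z : ℂ | z.im ≠ 0} :=
    (dense_compl_singleton (0:ℝ)).preimage Complex.isOpenMap_im
  have hc1 : Continuous fun z => gcJ ω z - gcJ (starRingEnd ℂ ω) z :=
    (gc_J_cont hn him.ne' hre).sub (gc_J_cont hn' him'.ne hre')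
  have hc2 : Continuous fun z => 2 * Real.pi * Complex.I * (Complex.Gamma z)⁻¹ :=
    continuous_const.mul Complex.differentiable_one_div_Gamma.continuous
  have := Continuous.ext_on hd hc1 hc2 (fun z hz => by
    obtain ⟨n, hn⟩ := exists_nat_ge (z.re + 2)
    exact hP n z hz (by linarith))
  exact congrFun this z

/-- one branch of the Wright integral -/
noncomputable def gcW (ω : ℂ) (α m t : ℝ) : ℂ :=
  ∫ x in Ioi (0:ℝ), Complex.exp (1 + x * ω) * (1 + x * ω) ^ (-(m:ℂ)) * ω * Complex.exp (-((1 + x * ω) ^ (α:ℂ) * t))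

lemma gc_norm_rpow {u : ℂ} (hu : u ≠ 0) (α : ℝ) : ‖u ^ (α:ℂ)‖ = ‖u‖ ^ α := by
  rw [Complex.norm_cpow_of_ne_zero hu]; simp

lemma gc_W_sum {ω : ℂ} (hn : ‖ω‖ = 1) (him : ω.im ≠ 0) (hre : ω.re < 0) {α : ℝ} (hα0 : 0 < α) (hα1 : α < 1)
    (m : ℝ) {t : ℝ} (ht : 0 < t) :
    HasSum (fun l : ℕ => ((-t) ^ l / l.factorial : ℂ) * gcJ ω (-α * l + m)) (gcW ω α m t) := by
  obtain ⟨C, hC, h⟩ := gc_cpow hn him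
  have hs : ∀ x ∈ Ioi (0:ℝ), (1 + x * ω : ℂ) ≠ 0 := fun x hx => by
    have := gc_slit him zero_le_one (le_of_lt hx) (Or.inl one_pos)
    simp only [Complex.ofReal_one] at this
    exact Complex.slitPlane_ne_zero this
  set B : ℕ → ℝ → ℝ := fun l x => Real.exp (1 + ω.re * x) * Real.exp (|m| * C + |m| * Real.log (1 + x)) *
    ((t * (1 + x) ^ α) ^ l / l.factorial) with hB
  have hsumB : ∀ x : ℝ, HasSum (fun l => B l x) (Real.exp (1 + ω.re * x) * Real.exp (|m| * C + |m| * Real.log (1 + x)) *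
     Real.exp (t * (1 + x) ^ α)) := by
    intro x
    apply HasSum.mul_left
    have := NormedSpace.expSeries_div_hasSum_exp (t * (1 + x) ^ α)
    rwa [← Real.exp_eq_exp_ℝ] at this
  have key := hasSum_integral_of_dominated_convergence (μ := volume.restrict (Ioi (0:ℝ)))
    (F := fun (l : ℕ) (x : ℝ) => ((-t) ^ l / l.factorial : ℂ) *
      (Complex.exp (1 + x * ω) * (1 + x * ω) ^ (-(-α * l + m : ℂ)) * ω))
    (f := fun x : ℝ => Complex.exp (1 + x * ω) * (1 + x * ω) ^ (-(m:ℂ)) * ω * Complex.exp (-((1 + x * ω) ^ (α:ℂ) * t)))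
    B ?_ ?_ ?_ ?_ ?_
  · simp only [integral_const_mul] at key
    exact key
  · intro l
    exact Measurable.aestronglyMeasurable (by fun_prop)
  · intro l
    filter_upwards [ae_restrict_mem measurableSet_Ioi] with x hx
    have hx' : (0:ℝ) < x := hx
    have e : (1 + x * ω : ℂ) ^ (-(-α * l + m : ℂ)) = (1 + x * ω) ^ (-(m:ℂ)) * ((1 + x * ω) ^ (α:ℂ)) ^ l := by
      rw [← Complex.cpow_mul_nat, ← Complex.cpow_add _ _ (hs x hx)]; congr 1; ring
    have h1 := h x hx'.le (-(m:ℂ)) |m| (by simp)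
    have h2 : ‖(1 + x * ω : ℂ) ^ (α:ℂ)‖ ≤ (1 + x) ^ α := by
      rw [gc_norm_rpow (hs x hx)]
      have := gc_norm_le hn zero_le_one le_rfl hx'.le
      simp only [Complex.ofReal_one] at this
      gcongr
    have h3 := gc_norm_exp (ω := ω) 1 x
    rw [Complex.ofReal_one] at h3
    rw [e]
    simp only [norm_mul, norm_div, norm_pow, norm_neg, Complex.norm_real, Real.norm_eq_abs, abs_of_pos ht, hn, h3,
      Complex.norm_natCast, hB]
    calc _ = Real.exp (1 + ω.re * x) * ‖(1 + x * ω : ℂ) ^ (-(m:ℂ))‖ * ((t * ‖(1 + x * ω : ℂ) ^ (α:ℂ)‖) ^ l / l.factorial) := by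
            rw [mul_pow]; ring
      _ ≤ _ := by gcongr
  · exact Filter.Eventually.of_forall fun x => (hsumB x).summable
  · simp only [fun x => (hsumB x).tsum_eq]
    refine (gc_master hα0 hα1 hre (1 + |m| * C) |m| t (abs_nonneg m)).congr (Filter.Eventually.of_forall fun x => ?_)
    simp only [← Real.exp_add]; congr 1; ring
  · filter_upwards [ae_restrict_mem measurableSet_Ioi] with x hx
    have := (NormedSpace.expSeries_div_hasSum_exp (-((1 + x * ω : ℂ) ^ (α:ℂ) * t))).mul_left
      (Complex.exp (1 + x * ω) * (1 + x * ω) ^ (-(m:ℂ)) * ω)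
    rw [← Complex.exp_eq_exp_ℂ] at this
    refine this.congr_fun ?_
    intro l
    have e : (1 + x * ω : ℂ) ^ (-(-α * l + m : ℂ)) = (1 + x * ω) ^ (-(m:ℂ)) * ((1 + x * ω) ^ (α:ℂ)) ^ l := by
      rw [← Complex.cpow_mul_nat, ← Complex.cpow_add _ _ (hs x hx)]; congr 1; ring
    rw [e, show -((1 + x * ω : ℂ) ^ (α:ℂ) * t) = (-t) * (1 + x * ω : ℂ) ^ (α:ℂ) by ring, mul_pow]
    ring

lemma gc_wright {ω : ℂ} (hn : ‖ω‖ = 1) (him : 0 < ω.im) (hre : ω.re < 0) {α : ℝ} (hα0 : 0 < α) (hα1 : α < 1)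
    (m : ℝ) {t : ℝ} (ht : 0 < t) :
    2 * Real.pi * Complex.I * (wright (-α) m (-t) : ℂ) = gcW ω α m t - gcW (starRingEnd ℂ ω) α m t := by
  have hn' : ‖starRingEnd ℂ ω‖ = 1 := by simpa using hn
  have him' : (starRingEnd ℂ ω).im < 0 := by simpa using him
  have hre' : (starRingEnd ℂ ω).re < 0 := by simpa using hre
  have h := (gc_W_sum hn him.ne' hre hα0 hα1 m ht).sub (gc_W_sum hn' him'.ne hre' hα0 hα1 m ht)
  rw [← h.tsum_eq, wright, Complex.ofReal_tsum, ← tsum_mul_left]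
  congr 1
  funext l
  have := gc_hankel hn him hre (-α * l + m)
  rw [← mul_sub, this]
  push_cast
  rw [← Complex.Gamma_ofReal]
  push_cast
  field_simp

lemma gc_arg {ω : ℂ} (hn : ‖ω‖ = 1) (him : ω.im ≠ 0) (hre : ω.re < 0) {x : ℝ} (hx : 0 ≤ x) :
    |Complex.arg (1 + x * ω)| ≤ |Complex.arg ω| := by
  have hω : ω ≠ 0 := fun h => him (by simp [h])
  have hu : (1 + x * ω : ℂ) ≠ 0 := by
    have := gc_slit him zero_le_one hx (Or.inl one_pos)
    simp only [Complex.ofReal_one] at this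
    exact Complex.slitPlane_ne_zero this
  by_contra hlt
  push Not at hlt
  have h1 := Real.cos_lt_cos_of_nonneg_of_le_pi (abs_nonneg _) (Complex.abs_arg_le_pi _) hlt
  rw [Real.cos_abs, Real.cos_abs, Complex.cos_arg hω, Complex.cos_arg hu, hn, div_one,
    div_lt_iff₀ (norm_pos_iff.2 hu)] at h1
  have h2 : x - 1 ≤ ‖(1 + x * ω : ℂ)‖ := by
    have : ‖(x * ω : ℂ)‖ ≤ ‖(1 + x * ω : ℂ)‖ + ‖(1:ℂ)‖ := by
      simpa using norm_sub_le (1 + x * ω : ℂ) 1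
    simp [hn, abs_of_nonneg hx] at this
    linarith
  have h3 : -1 ≤ ω.re := by
    have := Complex.abs_re_le_norm ω
    rw [hn] at this
    exact (abs_le.1 this).1
  simp at h1
  nlinarith

lemma gc_re_pow {ω : ℂ} (hn : ‖ω‖ = 1) (him : ω.im ≠ 0) (hre : ω.re < 0) {α : ℝ} (hα0 : 0 < α)
    (harg : α * |Complex.arg ω| < Real.pi / 2) :
    ∃ δ : ℝ, 0 < δ ∧ ∀ x : ℝ, 0 ≤ x → δ ≤ ((1 + x * ω : ℂ) ^ (α:ℂ)).re := by
  have hp : 0 < |ω.im| := abs_pos.2 him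
  have hcos : 0 < Real.cos (α * |Complex.arg ω|) := by
    apply Real.cos_pos_of_mem_Ioo
    have : 0 ≤ α * |Complex.arg ω| := by positivity
    constructor <;> linarith [Real.pi_pos]
  refine ⟨|ω.im| ^ α * Real.cos (α * |Complex.arg ω|), by positivity, fun x hx => ?_⟩
  have hu : (1 + x * ω : ℂ) ≠ 0 := by
    have := gc_slit him zero_le_one hx (Or.inl one_pos)
    simp only [Complex.ofReal_one] at this
    exact Complex.slitPlane_ne_zero this
  have e : ((1 + x * ω : ℂ) ^ (α:ℂ)).re = ‖(1 + x * ω : ℂ)‖ ^ α * Real.cos (α * |Complex.arg (1 + x * ω)|) := by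
    rw [Complex.cpow_def_of_ne_zero hu, Complex.exp_re, Complex.re_mul_ofReal, Complex.im_mul_ofReal,
      Complex.log_re, Complex.log_im, Real.rpow_def_of_pos (norm_pos_iff.2 hu), ← Real.cos_abs, abs_mul,
      abs_of_pos hα0, mul_comm α]
  rw [e]
  have h1 := gc_norm_ge hn x
  have h2 : Real.cos (α * |Complex.arg ω|) ≤ Real.cos (α * |Complex.arg (1 + x * ω)|) := by
    apply Real.cos_le_cos_of_nonneg_of_le_pi (by positivity) (by linarith [Real.pi_pos])
    have := gc_arg hn him hre hx
    gcongr
  gcongr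

lemma gc_mellin {ω : ℂ} (hn : ‖ω‖ = 1) (him : ω.im ≠ 0) (hre : ω.re < 0) {α : ℝ} (hα0 : 0 < α) (hα1 : α < 1)
    (harg : α * |Complex.arg ω| < Real.pi / 2) (m : ℝ) {s : ℂ} (hs : 0 < s.re) :
    IntegrableOn (fun t : ℝ => (t:ℂ) ^ (s - 1) * gcW ω α m t) (Ioi 0) ∧
    ∫ t in Ioi (0:ℝ), (t:ℂ) ^ (s - 1) * gcW ω α m t = Complex.Gamma s * gcJ ω (m + α * s) := by
  obtain ⟨δ, hδ, hδ'⟩ := gc_re_pow hn him hre hα0 harg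
  set F : ℝ → ℝ → ℂ := fun t x => (t:ℂ) ^ (s - 1) *
    (Complex.exp (1 + x * ω) * (1 + x * ω) ^ (-(m:ℂ)) * ω * Complex.exp (-((1 + x * ω) ^ (α:ℂ) * t))) with hF
  have hFint : Integrable (Function.uncurry F) ((volume.restrict (Ioi 0)).prod (volume.restrict (Ioi 0))) := by
    have h1 := gc_rpow_exp_int (s := s.re - 1) (b := δ) (by linarith) hδ
    have h2 := (gc_J_integrable hn him hre m).norm
    apply Integrable.mono' (Integrable.mul_prod h1 h2)
    · exact Measurable.aestronglyMeasurable (by rw [hF]; unfold Function.uncurry; fun_prop)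
    · rw [Measure.prod_restrict]
      filter_upwards [ae_restrict_mem (measurableSet_Ioi.prod measurableSet_Ioi)] with p hp
      have hp1 : 0 < p.1 := hp.1
      have hp2 : 0 < p.2 := hp.2
      have hd := hδ' p.2 hp2.le
      have hx : ‖(p.1:ℂ) ^ (s - 1) * Complex.exp (-((1 + p.2 * ω) ^ (α:ℂ) * p.1))‖ ≤
          p.1 ^ (s.re - 1) * Real.exp (-δ * p.1) := by
        rw [gc_gamma_norm _ _ hp1]
        simp only [Complex.sub_re, Complex.one_re]
        gcongr
      calc ‖Function.uncurry F p‖ = ‖(p.1:ℂ) ^ (s - 1) * Complex.exp (-((1 + p.2 * ω) ^ (α:ℂ) * p.1))‖ *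
            ‖Complex.exp (1 + p.2 * ω) * (1 + p.2 * ω) ^ (-(m:ℂ)) * ω‖ := by
              rw [← norm_mul, hF]; simp only [Function.uncurry]; congr 1; ring
        _ ≤ _ := by gcongr
  have hin : ∀ t : ℝ, ∫ x in Ioi (0:ℝ), F t x = (t:ℂ) ^ (s - 1) * gcW ω α m t := by
    intro t
    rw [hF, gcW, ← integral_const_mul]
  constructor
  · have := hFint.integral_prod_left
    simp only [Function.uncurry, hin] at this
    exact this
  · have hsw := integral_integral_swap hFint
    simp only [hin] at hsw
    rw [hsw, gcJ, ← integral_const_mul]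
    apply setIntegral_congr_fun measurableSet_Ioi
    intro x hx
    have hx' : (0:ℝ) < x := hx
    have hu : (1 + x * ω : ℂ) ≠ 0 := by
      have := gc_slit him zero_le_one hx'.le (Or.inl one_pos)
      simp only [Complex.ofReal_one] at this
      exact Complex.slitPlane_ne_zero this
    have hg := gc_gamma hs (lt_of_lt_of_le hδ (hδ' x hx'.le))
    have e : ∀ t : ℝ, F t x = (Complex.exp (1 + x * ω) * (1 + x * ω) ^ (-(m:ℂ)) * ω) *
        ((t:ℂ) ^ (s - 1) * Complex.exp (-((1 + x * ω) ^ (α:ℂ) * t))) := by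
      intro t; rw [hF]; ring
    simp only [e, integral_const_mul]
    rw [hg]
    have hb : |α * Complex.arg (1 + x * ω)| < Real.pi := by
      rw [abs_mul, abs_of_pos hα0]
      have := gc_arg hn him hre hx'.le
      have : α * |Complex.arg (1 + x * ω)| ≤ α * |Complex.arg ω| := by gcongr
      linarith [Real.pi_pos]
    rw [abs_lt] at hb
    have hi : (Complex.log (1 + x * ω) * α).im = α * Complex.arg (1 + x * ω) := by
      rw [Complex.im_mul_ofReal, Complex.log_im, mul_comm]
    rw [← Complex.cpow_mul _ (by rw [hi]; exact hb.1) (by rw [hi]; exact hb.2.le)]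
    have e2 : (1 + x * ω : ℂ) ^ (-(m + α * s : ℂ)) = (1 + x * ω) ^ (-(m:ℂ)) * (1 + x * ω) ^ (α * -s : ℂ) := by
      rw [← Complex.cpow_add _ _ hu]; congr 1; ring
    rw [e2]; ring

lemma gc_wright_mellin {r α : ℝ} (hα0 : 0 < α) (hα1 : α < 1) {s : ℂ} (hs : 0 < s.re) :
    IntegrableOn (fun t : ℝ => (t:ℂ) ^ (s - 1) * (wright (-α) (r * (1 - α)) (-t) : ℂ)) (Ioi 0) ∧
    ∫ t in Ioi (0:ℝ), (t:ℂ) ^ (s - 1) * (wright (-α) (r * (1 - α)) (-t) : ℂ) =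
      Complex.Gamma s * (Complex.Gamma (r * (1 - α) + α * s))⁻¹ := by
  set θ : ℝ := Real.pi / (1 + α) with hθ
  have hpi := Real.pi_pos
  have h1 : Real.pi / 2 < θ := by rw [hθ]; gcongr; linarith
  have h2 : θ < Real.pi := by rw [hθ]; apply div_lt_self hpi; linarith
  have h3 : α * θ < Real.pi / 2 := by
    rw [hθ, ← mul_div_assoc, div_lt_div_iff₀ (by linarith) (by norm_num)]; nlinarith
  set ω : ℂ := Complex.exp (θ * Complex.I) with hω
  have hn : ‖ω‖ = 1 := Complex.norm_exp_ofReal_mul_I θ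
  have him : 0 < ω.im := by
    rw [hω, Complex.exp_ofReal_mul_I_im]; exact Real.sin_pos_of_pos_of_lt_pi (by linarith) h2
  have hre : ω.re < 0 := by
    rw [hω, Complex.exp_ofReal_mul_I_re]; exact Real.cos_neg_of_pi_div_two_lt_of_lt h1 (by linarith)
  have ha : Complex.arg ω = θ := by
    rw [hω, Complex.arg_exp_mul_I, toIocMod_eq_self]; constructor <;> linarith
  have hn' : ‖starRingEnd ℂ ω‖ = 1 := by simpa using hn
  have him' : (starRingEnd ℂ ω).im < 0 := by simpa using him
  have hre' : (starRingEnd ℂ ω).re < 0 := by simpa using hre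
  have hab : |Complex.arg ω| = θ := by rw [ha, abs_of_pos (by linarith)]
  have hab' : |Complex.arg (starRingEnd ℂ ω)| = θ := by
    rw [Complex.arg_conj, if_neg (by rw [ha]; exact h2.ne), abs_neg, hab]
  obtain ⟨i1, m1⟩ := gc_mellin hn him.ne' hre hα0 hα1 (by rw [hab]; exact h3) (r * (1 - α)) hs
  obtain ⟨i2, m2⟩ := gc_mellin hn' him'.ne hre' hα0 hα1 (by rw [hab']; exact h3) (r * (1 - α)) hs
  have hpc : (2 * Real.pi * Complex.I : ℂ) ≠ 0 := Complex.two_pi_I_ne_zero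
  have e : ∀ t ∈ Ioi (0:ℝ), (2 * Real.pi * Complex.I : ℂ)⁻¹ * ((t:ℂ) ^ (s - 1) * gcW ω α (r * (1 - α)) t -
      (t:ℂ) ^ (s - 1) * gcW (starRingEnd ℂ ω) α (r * (1 - α)) t) =
      (t:ℂ) ^ (s - 1) * (wright (-α) (r * (1 - α)) (-t) : ℂ) := by
    intro t ht
    have := gc_wright hn him hre hα0 hα1 (r * (1 - α)) ht
    rw [← mul_sub, ← this]
    field_simp
  constructor
  · exact IntegrableOn.congr_fun (Integrable.const_mul (IntegrableOn.sub i1 i2) _) e measurableSet_Ioi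
  · rw [← setIntegral_congr_fun measurableSet_Ioi e, integral_const_mul, integral_sub i1 i2, m1, m2, ← mul_sub,
      gc_hankel hn him hre]
    push_cast
    field_simp

lemma gc_cpow_exp {t : ℝ} (ht : 0 < t) (r τ : ℝ) :
    ((t ^ (r - 1) : ℝ) : ℂ) * Complex.exp (τ * Real.log t * Complex.I) = (t:ℂ) ^ ((r + τ * Complex.I : ℂ) - 1) := by
  have htc : (t:ℂ) ≠ 0 := Complex.ofReal_ne_zero.2 ht.ne'
  rw [Complex.ofReal_cpow ht.le, Complex.cpow_def_of_ne_zero htc, Complex.cpow_def_of_ne_zero htc, ← Complex.exp_add,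
    Complex.ofReal_log ht.le]
  congr 1; push_cast; ring

lemma gc_charFun_density (ν : Measure ℝ) (w : ℝ → ℝ) (hw : AEMeasurable w (volume.restrict (Ioi 0)))
    (hw0 : ∀ᵐ t ∂(volume.restrict (Ioi (0:ℝ))), 0 ≤ w t)
    (hν : ν = (volume.restrict (Ioi (0:ℝ))).withDensity (fun t => ENNReal.ofReal (w t))) (τ : ℝ) :
    ∫ t, Complex.exp (τ * Real.log t * Complex.I) ∂ν =
      ∫ t in Ioi (0:ℝ), (w t : ℂ) * Complex.exp (τ * Real.log t * Complex.I) := by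
  rw [hν, integral_withDensity_eq_integral_toReal_smul₀ hw.ennreal_ofReal (Filter.Eventually.of_forall fun _ => ENNReal.ofReal_lt_top)]
  apply integral_congr_ae
  filter_upwards [hw0] with t ht
  rw [ENNReal.toReal_ofReal ht, Complex.real_smul]

lemma gc_nonneg {ν : Measure ℝ} [IsProbabilityMeasure ν] {w : ℝ → ℝ} (hw : IntegrableOn w (Ioi 0))
    (h1 : ∫ t in Ioi (0:ℝ), w t = 1)
    (hν : ν = (volume.restrict (Ioi (0:ℝ))).withDensity (fun t => ENNReal.ofReal (w t))) :
    ∀ᵐ t ∂(volume.restrict (Ioi (0:ℝ))), 0 ≤ w t := by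
  have hu : ∫⁻ t in Ioi (0:ℝ), ENNReal.ofReal (w t) = 1 := by
    have : ν univ = 1 := measure_univ
    rwa [hν, withDensity_apply _ MeasurableSet.univ, Measure.restrict_univ] at this
  rw [integral_eq_lintegral_pos_part_sub_lintegral_neg_part hw, hu] at h1
  have h0 : (∫⁻ t in Ioi (0:ℝ), ENNReal.ofReal (-w t)).toReal = 0 := by simpa using h1
  have hfin : ∫⁻ t in Ioi (0:ℝ), ENNReal.ofReal (-w t) ≠ ⊤ := by
    exact (Integrable.lintegral_lt_top hw.neg).ne
  have h2 : ∫⁻ t in Ioi (0:ℝ), ENNReal.ofReal (-w t) = 0 := by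
    rcases (ENNReal.toReal_eq_zero_iff _).1 h0 with h | h
    · exact h
    · exact absurd h hfin
  have hms : AEMeasurable (fun t => ENNReal.ofReal (-w t)) (volume.restrict (Ioi (0:ℝ))) :=
    hw.neg.aemeasurable.ennreal_ofReal
  rw [lintegral_eq_zero_iff' hms] at h2
  filter_upwards [h2] with t ht
  have := ENNReal.ofReal_eq_zero.1 ht
  linarith

lemma gc_Y {r α : ℝ} (hr : 0 < r) (hα0 : 0 < α) (hα1 : α < 1) {ν : Measure ℝ} [IsProbabilityMeasure ν]
    (hν : ν = (volume.restrict (Ioi (0 : ℝ))).withDensity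
        (fun t => ENNReal.ofReal (t ^ (r - 1) * wright (-α) (r * (1 - α)) (-t)))) (τ : ℝ) :
    ∫ t, Complex.exp (τ * Real.log t * Complex.I) ∂ν =
      Complex.Gamma (r + τ * Complex.I) * (Complex.Gamma (r + (α * τ : ℝ) * Complex.I))⁻¹ := by
  obtain ⟨hi, hm⟩ := gc_wright_mellin (r := r) hα0 hα1 (s := r) (by simpa using hr)
  have e : ∀ t ∈ Ioi (0:ℝ), (t:ℂ) ^ ((r:ℂ) - 1) * (wright (-α) (r * (1 - α)) (-t) : ℂ) =
      ((t ^ (r - 1) * wright (-α) (r * (1 - α)) (-t) : ℝ) : ℂ) := by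
    intro t ht
    have ht' : (0:ℝ) < t := ht
    push_cast
    rw [Complex.ofReal_cpow ht'.le]; push_cast; rfl
  have hi' : IntegrableOn (fun t : ℝ => t ^ (r - 1) * wright (-α) (r * (1 - α)) (-t)) (Ioi 0) := by
    have := IntegrableOn.congr_fun hi e measurableSet_Ioi
    have h2 := Integrable.re this
    simpa [IntegrableOn] using h2
  have h1 : ∫ t in Ioi (0:ℝ), t ^ (r - 1) * wright (-α) (r * (1 - α)) (-t) = 1 := by
    rw [setIntegral_congr_fun measurableSet_Ioi e, integral_complex_ofReal] at hm
    have hg : Complex.Gamma r ≠ 0 := Complex.Gamma_ne_zero_of_re_pos (by simpa using hr)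
    rw [show (r * (1 - α) + α * r : ℂ) = r by ring, mul_inv_cancel₀ hg] at hm
    exact_mod_cast hm
  have h0 := gc_nonneg hi' h1 hν
  rw [gc_charFun_density ν _ hi'.aemeasurable h0 hν]
  have hm2 := (gc_wright_mellin (r := r) hα0 hα1 (s := r + τ * Complex.I) (by simpa using hr)).2
  rw [show (r * (1 - α) + α * (r + τ * Complex.I) : ℂ) = r + (α * τ : ℝ) * Complex.I by push_cast; ring] at hm2
  rw [← hm2]
  apply setIntegral_congr_fun measurableSet_Ioi
  intro t ht
  simp only [← gc_cpow_exp ht]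
  push_cast; ring

lemma gc_G {r : ℝ} (hr : 0 < r) {ν : Measure ℝ}
    (hν : ν = (volume.restrict (Ioi (0 : ℝ))).withDensity
        (fun t => ENNReal.ofReal (t ^ (r - 1) * Real.exp (-t) / Real.Gamma r))) (τ : ℝ) :
    ∫ t, Complex.exp (τ * Real.log t * Complex.I) ∂ν =
      Complex.Gamma (r + τ * Complex.I) * (Complex.Gamma r)⁻¹ := by
  have hG : 0 < Real.Gamma r := Real.Gamma_pos_of_pos hr
  rw [gc_charFun_density ν _ (Measurable.aemeasurable (by fun_prop)) (by
    filter_upwards [ae_restrict_mem measurableSet_Ioi] with t ht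
    have ht' : (0:ℝ) < t := ht
    positivity) hν]
  have h := gc_gamma (a := r + τ * Complex.I) (c := 1) (by simpa using hr) (by simp)
  rw [Complex.one_cpow, one_mul] at h
  rw [← h, ← integral_mul_const]
  apply setIntegral_congr_fun measurableSet_Ioi
  intro t ht
  simp only [← gc_cpow_exp ht]
  rw [Complex.Gamma_ofReal]
  push_cast; ring_nf

lemma gc_G_prob {r : ℝ} (hr : 0 < r) : IsProbabilityMeasure ((volume.restrict (Ioi (0 : ℝ))).withDensity
        (fun t => ENNReal.ofReal (t ^ (r - 1) * Real.exp (-t) / Real.Gamma r))) := by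
  have hG : 0 < Real.Gamma r := Real.Gamma_pos_of_pos hr
  constructor
  rw [withDensity_apply _ MeasurableSet.univ, Measure.restrict_univ, ← ofReal_integral_eq_lintegral_ofReal]
  · rw [integral_div, ← ENNReal.ofReal_one]
    congr 1
    rw [div_eq_one_iff_eq hG.ne', Real.Gamma_eq_integral hr]
    simp only [mul_comm]
  · have := Real.GammaIntegral_convergent hr
    simp only [mul_comm (Real.exp _)] at this
    exact this.div_const _
  · filter_upwards [ae_restrict_mem measurableSet_Ioi] with t ht
    have ht' : (0:ℝ) < t := ht
    simp only [Pi.zero_apply]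
    positivity

lemma gc_fixed {φ : ℝ → ℂ} (hφ : Continuous φ) (h0 : φ 0 = 1) {r α : ℝ} (hr : 0 < r) (hα0 : 0 < α) (hα1 : α < 1)
    (h : ∀ τ : ℝ, φ τ = φ (α * τ) *
      (Complex.Gamma (r + τ * Complex.I) * (Complex.Gamma (r + (α * τ : ℝ) * Complex.I))⁻¹)) (τ : ℝ) :
    φ τ = Complex.Gamma (r + τ * Complex.I) * (Complex.Gamma r)⁻¹ := by
  have hg : ∀ τ : ℝ, Complex.Gamma (r + τ * Complex.I) ≠ 0 := fun τ =>
    Complex.Gamma_ne_zero_of_re_pos (by simpa using hr)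
  set g : ℝ → ℂ := fun τ => φ τ * (Complex.Gamma (r + τ * Complex.I))⁻¹ with hgdef
  have hgc : Continuous g := hφ.mul (Complex.differentiable_one_div_Gamma.continuous.comp (by fun_prop))
  have hgs : ∀ τ, g τ = g (α * τ) := by
    intro τ
    simp only [hgdef]
    rw [h τ]
    have := hg τ
    field_simp
  have hgn : ∀ n : ℕ, g τ = g (α ^ n * τ) := by
    intro n
    induction n with
    | zero => simp
    | succ n ih => rw [ih, hgs, pow_succ']; congr 1; ring
  have ht : Filter.Tendsto (fun n : ℕ => g (α ^ n * τ)) Filter.atTop (nhds (g 0)) := by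
    apply (hgc.tendsto 0).comp
    simpa using (tendsto_pow_atTop_nhds_zero_of_lt_one hα0.le hα1).mul_const τ
  have hc : g τ = g 0 := by
    apply tendsto_nhds_unique _ ht
    simp only [← hgn]; exact tendsto_const_nhds
  simp only [hgdef, h0] at hc
  have := hg τ
  field_simp at hc
  rw [hc]
  simp [div_eq_mul_inv]

lemma gc_charFun_log (ν : Measure ℝ) (τ : ℝ) :
    charFun (ν.map Real.log) τ = ∫ t, Complex.exp (τ * Real.log t * Complex.I) ∂ν := by
  rw [charFun_apply_real, integral_map Real.measurable_log.aemeasurable (Measurable.aestronglyMeasurable (by fun_prop))]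

lemma gc_map_exp_log {ν : Measure ℝ} (h : ∀ᵐ x ∂ν, 0 < x) : (ν.map Real.log).map Real.exp = ν := by
  rw [Measure.map_map Real.measurable_exp Real.measurable_log]
  conv_rhs => rw [← Measure.map_id (μ := ν)]
  apply Measure.map_congr
  filter_upwards [h] with x hx
  simp [Real.exp_log hx]

lemma gc_density_pos {ν : Measure ℝ} {f : ℝ → ENNReal} (h : ν = (volume.restrict (Ioi (0:ℝ))).withDensity f) :
    ∀ᵐ x ∂ν, 0 < x := by
  rw [h]
  exact (withDensity_absolutelyContinuous _ _).ae_le (ae_restrict_mem measurableSet_Ioi)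

theorem gamma_characterization
    {Ω : Type*} [MeasurableSpace Ω] (μ : Measure Ω) [IsProbabilityMeasure μ]
    (r α : ℝ) (hr : 0 < r) (hα0 : 0 < α) (hα1 : α < 1)
    (Z Y : Ω → ℝ) (hZ : Measurable Z) (hY : Measurable Y)
    (hpos : ∀ ω, 0 < Z ω)
    (hindep : ProbabilityTheory.IndepFun Z Y μ)
    (ρ : ℝ → ℝ) (hρcont : ContinuousOn ρ (Ioi 0))
    (hlawZ : μ.map Z =
      (volume.restrict (Ioi (0 : ℝ))).withDensity (fun x => ENNReal.ofReal (ρ x)))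
    (hMellin : ∀ z : ℂ, 1 - r < z.re →
      IntegrableOn (fun x : ℝ => (x : ℂ) ^ (z - 1) * (ρ x : ℂ)) (Ioi 0))
    (hlawY : μ.map Y =
      (volume.restrict (Ioi (0 : ℝ))).withDensity
        (fun t => ENNReal.ofReal (t ^ (r - 1) * wright (-α) (r * (1 - α)) (-t))))
    (hdecomp : μ.map Z = μ.map (fun ω => Z ω ^ α * Y ω)) :
    μ.map Z =
      (volume.restrict (Ioi (0 : ℝ))).withDensity
        (fun t => ENNReal.ofReal (t ^ (r - 1) * Real.exp (-t) / Real.Gamma r)) := by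
  have := gc_G_prob hr
  set γ := (volume.restrict (Ioi (0 : ℝ))).withDensity
        (fun t => ENNReal.ofReal (t ^ (r - 1) * Real.exp (-t) / Real.Gamma r)) with hγ
  have pZ : IsProbabilityMeasure (μ.map Z) := Measure.isProbabilityMeasure_map hZ.aemeasurable
  have pY : IsProbabilityMeasure (μ.map Y) := Measure.isProbabilityMeasure_map hY.aemeasurable
  have pL : IsProbabilityMeasure ((μ.map Z).map Real.log) :=
    Measure.isProbabilityMeasure_map Real.measurable_log.aemeasurable
  have pG : IsProbabilityMeasure (γ.map Real.log) :=
    Measure.isProbabilityMeasure_map Real.measurable_log.aemeasurable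
  have hYpos : ∀ᵐ ω ∂μ, 0 < Y ω := ae_of_ae_map hY.aemeasurable (gc_density_pos hlawY)
  have hZα : Measurable (fun ω => Z ω ^ α * Y ω) := (hZ.pow_const α).mul hY
  have hm : ∀ τ : ℝ, Measurable (fun t : ℝ => Complex.exp (τ * Real.log t * Complex.I)) := fun τ => by fun_prop
  have hfe : ∀ τ : ℝ, charFun ((μ.map Z).map Real.log) τ = charFun ((μ.map Z).map Real.log) (α * τ) *
      (Complex.Gamma (r + τ * Complex.I) * (Complex.Gamma (r + (α * τ : ℝ) * Complex.I))⁻¹) := by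
    intro τ
    rw [← gc_Y hr hα0 hα1 hlawY τ, gc_charFun_log, gc_charFun_log]
    conv_lhs => rw [hdecomp]
    rw [integral_map hZα.aemeasurable (hm τ).aestronglyMeasurable,
      integral_map hZ.aemeasurable (hm _).aestronglyMeasurable,
      integral_map hY.aemeasurable (hm τ).aestronglyMeasurable]
    have hi := (hindep.comp (hm (α * τ)) (hm τ)).integral_fun_mul_eq_mul_integral
      ((hm (α * τ)).comp hZ).aestronglyMeasurable ((hm τ).comp hY).aestronglyMeasurable
    simp only [Function.comp] at hi
    rw [← hi]
    apply integral_congr_ae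
    filter_upwards [hYpos] with ω hω
    rw [Real.log_mul (Real.rpow_pos_of_pos (hpos ω) α).ne' hω.ne', Real.log_rpow (hpos ω), ← Complex.exp_add]
    congr 1; push_cast; ring
  have hphi := gc_fixed continuous_charFun (by simp) hr hα0 hα1 hfe
  have hlog : (μ.map Z).map Real.log = γ.map Real.log := by
    apply Measure.ext_of_charFun
    funext τ
    rw [hphi τ, gc_charFun_log, gc_G hr hγ τ]
  rw [← gc_map_exp_log (gc_density_pos hlawZ), hlog, gc_map_exp_log (gc_density_pos hγ)]
end

section
/- Let U be a standard normal random variable and 0 < α < 1. Let X_α be an independent random variable with density ρ(t) = 2^((α+1)/2) W_{-α,(1-α)/2}(-2^(α-1) t²) on (0,∞). Then |U| has the same distribution as |U|^α · X_α. -/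
open MeasureTheory Set ProbabilityTheory

open Complex Filter Topology

lemma norm_cpow_exp {a z : ℂ} {t : ℝ} (ht : 0 < t) : 
    ‖(t:ℂ)^(a-1) * cexp (-(z * t))‖ = t ^ (a.re - 1) * Real.exp (-(z.re) * t) := by
  rw [norm_mul, Complex.norm_cpow_eq_rpow_re_of_pos ht, Complex.norm_exp]
  simp

lemma int_cpow_exp {a z : ℂ} (ha : 0 < a.re) (hz : 0 < z.re) :
    IntegrableOn (fun t : ℝ => (t:ℂ)^(a-1) * cexp (-(z * t))) (Ioi 0) := by
  have h := integrableOn_rpow_mul_exp_neg_mul_rpow (p := 1) (s := a.re - 1) (b := z.re) (by linarith) one_pos hz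
  refine Integrable.mono' h ?_ ?_
  · apply ContinuousOn.aestronglyMeasurable _ measurableSet_Ioi
    intro t (ht : 0 < t)
    apply ContinuousAt.continuousWithinAt
    apply ContinuousAt.mul
    · exact Complex.continuousAt_ofReal_cpow_const _ _ (Or.inr ht.ne')
    · fun_prop
  · filter_upwards [ae_restrict_mem measurableSet_Ioi] with t (ht : 0 < t)
    rw [norm_cpow_exp ht, Real.rpow_one]

lemma cgamma {a z : ℂ} (ha : 0 < a.re) (hz : 0 < z.re) :
    ∫ t in Ioi (0:ℝ), (t:ℂ)^(a-1) * cexp (-(z * t)) = (1/z)^a * Gamma a := by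
  have hop : IsOpen {z : ℂ | 0 < z.re} := isOpen_lt continuous_const Complex.continuous_re
  have hconv : Convex ℝ {z : ℂ | 0 < z.re} := convex_halfSpace_re_gt 0
  have hF : DifferentiableOn ℂ (fun z : ℂ => ∫ t in Ioi (0:ℝ), (t:ℂ)^(a-1) * cexp (-(z * t))) {z : ℂ | 0 < z.re} := by
    intro z (hz : 0 < z.re)
    apply DifferentiableAt.differentiableWithinAt
    have key := hasDerivAt_integral_of_dominated_loc_of_deriv_le (μ := volume.restrict (Ioi (0:ℝ)))
      (F := fun (z:ℂ) (t:ℝ) => (t:ℂ)^(a-1) * cexp (-(z * t))) 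
      (F' := fun (z:ℂ) (t:ℝ) => (t:ℂ)^(a-1) * (cexp (-(z * t)) * (-t))) (x₀ := z)
      (s := Metric.ball z (z.re/2)) (bound := fun t => t ^ (a.re) * Real.exp (-(z.re/2) * t^(1:ℝ)))
      (Metric.ball_mem_nhds _ (by positivity)) ?_ (int_cpow_exp ha hz) ?_ ?_ ?_ ?_
    · exact key.2.differentiableAt
    · filter_upwards [hop.mem_nhds hz] with w hw
      exact (int_cpow_exp ha hw).aestronglyMeasurable
    · have := (int_cpow_exp ha hz).aestronglyMeasurable
      have h2 : Continuous (fun t : ℝ => -(t:ℂ)) := by fun_prop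
      have := this.mul h2.aestronglyMeasurable
      refine this.congr (Eventually.of_forall fun t => ?_)
      simp [mul_assoc]
    · filter_upwards [ae_restrict_mem measurableSet_Ioi] with t (ht : 0 < t)
      intro w hw
      rw [← mul_assoc, norm_mul, norm_cpow_exp ht, norm_neg, Complex.norm_real, Real.norm_of_nonneg ht.le, Real.rpow_one]
      have hw' : z.re / 2 ≤ w.re := by
        have h1 := Complex.abs_re_le_norm (w - z)
        rw [Metric.mem_ball, dist_eq_norm] at hw
        have := (abs_lt.1 (h1.trans_lt hw)).1
        simp at this; linarith
      calc t ^ (a.re - 1) * Real.exp (-(w.re) * t) * t = t ^ a.re * Real.exp (-(w.re) * t) := by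
              rw [Real.rpow_sub_one ht.ne']; field_simp
        _ ≤ _ := by gcongr
    · have := integrableOn_rpow_mul_exp_neg_mul_rpow (p := 1) (s := a.re) (b := z.re/2) (by linarith) one_pos (by linarith)
      exact this
    · filter_upwards with t
      intro w hw
      have : HasDerivAt (fun z : ℂ => -(z * t)) (-t : ℂ) w := by
        exact (hasDerivAt_mul_const (x := w) (t:ℂ)).neg
      exact this.cexp.const_mul _
  have hG : DifferentiableOn ℂ (fun z : ℂ => (1/z)^a * Gamma a) {z : ℂ | 0 < z.re} := by
    intro z (hz : 0 < z.re)
    apply DifferentiableAt.differentiableWithinAt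
    have hz0 : z ≠ 0 := by rintro rfl; simp at hz
    apply DifferentiableAt.mul_const
    apply DifferentiableAt.cpow_const
    · exact (differentiableAt_const _).div differentiableAt_id hz0
    · left
      simp only [one_div, Complex.inv_re]
      exact div_pos hz (Complex.normSq_pos.2 hz0)
  have := (hF.analyticOnNhd hop).eqOn_of_preconnected_of_frequently_eq (hG.analyticOnNhd hop) hconv.isPreconnected
    (z₀ := 1) (by simp) ?_
  · exact this hz
  · have ht : Tendsto (fun x : ℝ => (x:ℂ)) (𝓝[≠] 1) (𝓝[≠] 1) := by
      apply tendsto_nhdsWithin_of_tendsto_nhds_of_eventually_within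
      · have : Tendsto (fun x : ℝ => (x:ℂ)) (𝓝 1) (𝓝 ((1:ℝ):ℂ)) := Complex.continuous_ofReal.tendsto 1
        simpa using this.mono_left nhdsWithin_le_nhds
      · filter_upwards [self_mem_nhdsWithin] with x hx
        simpa using hx
    apply ht.frequently
    apply Eventually.frequently
    have : ∀ᶠ x : ℝ in 𝓝[≠] 1, 0 < x := nhdsWithin_le_nhds (lt_mem_nhds one_pos)
    filter_upwards [this] with x hx
    exact Complex.integral_cpow_mul_exp_neg_mul_Ioi ha hx

lemma cos_pos' {φ : ℝ} (h1 : |φ| < Real.pi/2) : 0 < Real.cos φ :=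
  Real.cos_pos_of_mem_Ioo ⟨by linarith [(abs_lt.1 h1).1], (abs_lt.1 h1).2⟩

lemma pol {A φ : ℝ} (hA : 0 < A) (h1 : |φ| < Real.pi/2) {a : ℂ} (ha : 0 < a.re) :
   ∫ r in Ioi (0:ℝ), (r:ℂ)^(a-1) * cexp (-(A * cexp (φ * I) * r)) = cexp (-(a * (Real.log A + φ * I))) * Gamma a := by
  have hcos : 0 < Real.cos φ := cos_pos' h1
  have hre : 0 < (A * cexp (φ * I)).re := by
    rw [Complex.re_ofReal_mul, Complex.exp_ofReal_mul_I_re]; positivity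
  rw [cgamma ha hre]
  congr 1
  have hA' : (A:ℂ) ≠ 0 := by exact_mod_cast hA.ne'
  have e : 1 / (A * cexp (φ * I)) = cexp (-(Real.log A + φ * I)) := by
    rw [Complex.exp_neg, Complex.exp_add, ← Complex.ofReal_exp, Real.exp_log hA, one_div]
  rw [e, Complex.cpow_def_of_ne_zero (Complex.exp_ne_zero _), Complex.log_exp]
  · congr 1; ring
  · simp; linarith [(abs_lt.1 h1).2, Real.pi_pos]
  · simp; linarith [(abs_lt.1 h1).1, Real.pi_pos]

lemma gaussM {A φ : ℝ} (hA : 0 < A) (h1 : |φ| < Real.pi/2) (τ : ℝ) :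
   ∫ t in Ioi (0:ℝ), cexp (τ * Real.log t * I) * cexp (-(A * cexp (φ * I) * t^2)) = 
     1/2 * (cexp (-((1+τ*I)/2 * (Real.log A + φ * I))) * Gamma ((1+τ*I)/2)) := by
  rw [← pol hA h1 (by simp), ← integral_comp_rpow_Ioi (fun r : ℝ => (r:ℂ)^((1+τ*I)/2-1) * cexp (-(A * cexp (φ * I) * r))) (two_ne_zero (α := ℝ)), ← integral_const_mul]
  apply setIntegral_congr_fun measurableSet_Ioi
  intro t (ht : 0 < t)
  have ht' : (t:ℂ) ≠ 0 := by exact_mod_cast ht.ne'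
  have e1 : t ^ (2-1:ℝ) = t := by norm_num
  have e2 : ((t ^ (2:ℝ) : ℝ) : ℂ) = cexp (2 * Real.log t) := by
    rw [Real.rpow_def_of_pos ht]; push_cast; ring_nf
  have e3 : (t:ℂ)^2 = cexp (2 * Real.log t) := by 
    rw [← e2]; norm_cast
  have e4 : (t:ℂ) = cexp (Real.log t) := by rw [← Complex.ofReal_exp, Real.exp_log ht]
  simp only [e1, Complex.real_smul]
  rw [e2, e3, Complex.cpow_def_of_ne_zero (Complex.exp_ne_zero _)]
  have e5 : Complex.log (cexp (2 * Real.log t)) = 2 * Real.log t := by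
    rw [Complex.log_exp] <;> simp [Real.pi_pos, Real.pi_pos.le]
  rw [e5]
  have : cexp (τ * Real.log t * I) = t * cexp (2 * Real.log t * ((1 + τ * I)/2 - 1)) := by
    rw [e4, ← Complex.exp_add]; congr 1; ring
  rw [this]
  have h2: |(2:ℝ)| = 2 := by norm_num
  rw [h2]
  push_cast; ring

lemma hsc {f g : ℕ → ℂ} {a : ℂ} (h : ∀ l, f l = g l) (hf : HasSum f a) : HasSum g a := by
  rwa [← funext h]

/-- kernel -/
noncomputable def Kf (α φ : ℝ) (x r : ℝ) : ℂ :=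
  ((r ^ ((α-1)/2) : ℝ) : ℂ) * cexp (-(cexp (-φ * I) * r)) * cexp (-(((x * r^α : ℝ) : ℂ) * cexp (φ * I)))

lemma Kf_meas (α φ : ℝ) : Measurable (fun p : ℝ × ℝ => Kf α φ p.1 p.2) := by
  unfold Kf; fun_prop

lemma Kf_norm (α φ x : ℝ) {r : ℝ} (hr : 0 < r) :
    ‖Kf α φ x r‖ = r ^ ((α-1)/2) * Real.exp (-(Real.cos φ) * r) * Real.exp (-(x * r^α * Real.cos φ)) := by
  unfold Kf
  have h : cexp (-φ * I) = cexp (((-φ : ℝ) : ℂ) * I) := by push_cast; rfl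
  rw [h, norm_mul, norm_mul, Complex.norm_real, Complex.norm_exp, Complex.norm_exp, Real.norm_of_nonneg (by positivity)]
  congr 3
  · rw [Complex.neg_re, mul_comm, Complex.re_ofReal_mul, Complex.exp_ofReal_mul_I_re, Real.cos_neg]; ring
  · rw [Complex.neg_re, Complex.re_ofReal_mul, Complex.exp_ofReal_mul_I_re]

lemma young {α : ℝ} (h0 : 0 < α) (h1 : α < 1) {x : ℝ} (hx : 0 ≤ x) {e : ℝ} (he : 0 < e) :
    ∃ M : ℝ, ∀ r : ℝ, 0 < r → x * r ^ α ≤ e * r + M := by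
  refine ⟨e * (x/e) ^ (1/(1-α)), fun r hr => ?_⟩
  have hB : 0 ≤ (x/e) ^ (1/(1-α)) := by positivity
  have h := Real.geom_mean_le_arith_mean2_weighted h0.le (by linarith : 0 ≤ 1 - α) hr.le hB (by ring)
  rw [← Real.rpow_mul (by positivity), one_div_mul_cancel (by linarith), Real.rpow_one] at h
  have h2 : α * r + (1-α) * (x/e) ^ (1/(1-α)) ≤ r + (x/e) ^ (1/(1-α)) := by nlinarith
  have := mul_le_mul_of_nonneg_left (h.trans h2) he.le
  calc x * r ^ α = e * (r ^ α * (x/e)) := by field_simp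
    _ ≤ _ := by linarith

lemma Jseries {α φ x : ℝ} (h0 : 0 < α) (h1 : α < 1) (hφ : |φ| < Real.pi/2) (hx : 0 ≤ x) :
    HasSum (fun l : ℕ => (((-x)^l / l.factorial : ℝ) : ℂ) * cexp (φ * I * l) *
        (cexp (((α * l + (1+α)/2 : ℝ):ℂ) * (φ * I)) * Gamma ((α * l + (1+α)/2 : ℝ):ℂ)))
      (∫ r in Ioi (0:ℝ), Kf α φ x r) := by
  have hc := cos_pos' hφ
  have hφ' : |-φ| < Real.pi/2 := by rwa [abs_neg]
  have hb : ∀ l : ℕ, 0 < ((α * l + (1+α)/2 : ℝ):ℂ).re := fun l => by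
    rw [Complex.ofReal_re]; positivity
  have key := hasSum_integral_of_dominated_convergence (μ := volume.restrict (Ioi (0:ℝ)))
    (F := fun (l : ℕ) (r : ℝ) => (((-x)^l / l.factorial : ℝ) : ℂ) * cexp (φ * I * l) * 
      ((r:ℂ) ^ (((α * l + (1+α)/2 : ℝ):ℂ) - 1) * cexp (-(((1:ℝ):ℂ) * cexp ((-φ : ℝ) * I) * r))))
    (f := Kf α φ x) 
    (fun l r => r ^ ((α-1)/2) * Real.exp (-(Real.cos φ) * r) * ((x * r ^ α)^l / l.factorial)) ?_ ?_ ?_ ?_ ?_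
  · refine hsc (fun l => ?_) key
    rw [integral_const_mul, pol one_pos hφ' (hb l)]
    congr 3
    simp
  · intro l
    refine ((int_cpow_exp (hb l) ?_).const_mul _).aestronglyMeasurable
    rw [Complex.re_ofReal_mul, Complex.exp_ofReal_mul_I_re, Real.cos_neg]; simpa using hc
  · intro l
    filter_upwards [ae_restrict_mem measurableSet_Ioi] with r (hr : 0 < r)
    apply le_of_eq
    rw [norm_mul, norm_cpow_exp hr, norm_mul, Complex.norm_real]
    have e1 : ‖cexp (φ * I * l)‖ = 1 := by
      rw [Complex.norm_exp]; simp
    have e2 : (((1:ℝ):ℂ) * cexp ((-φ : ℝ) * I)).re = Real.cos φ := by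
      rw [Complex.re_ofReal_mul, Complex.exp_ofReal_mul_I_re, Real.cos_neg, one_mul]
    rw [e1, e2, Complex.ofReal_re, norm_div, norm_pow, norm_neg, Real.norm_of_nonneg hx, Real.norm_natCast]
    have e3 : r ^ (α * l + (1+α)/2 - 1) = r ^ ((α-1)/2) * (r ^ α)^l := by
      rw [← Real.rpow_mul_natCast hr.le, ← Real.rpow_add hr]; congr 1; ring
    rw [e3, mul_pow]; ring
  · filter_upwards with r
    exact (Real.summable_pow_div_factorial _).mul_left _
  · obtain ⟨M, hM⟩ := young h0 h1 hx (half_pos hc)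
    have hi := integrableOn_rpow_mul_exp_neg_mul_rpow (p := 1) (s := (α-1)/2) (b := Real.cos φ/2) (by linarith) one_pos (half_pos hc)
    refine Integrable.mono' (hi.const_mul (Real.exp M)) ?_ ?_
    · simp_rw [tsum_mul_left]
      have : ∀ r : ℝ, ∑' l : ℕ, (x * r ^ α)^l / l.factorial = Real.exp (x * r ^ α) := fun r => by
        rw [Real.exp_eq_exp_ℝ, NormedSpace.exp_eq_tsum_div]
      simp_rw [this]
      apply Measurable.aestronglyMeasurable; fun_prop
    · filter_upwards [ae_restrict_mem measurableSet_Ioi] with r (hr : 0 < r)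
      rw [tsum_mul_left]
      have : ∑' l : ℕ, (x * r ^ α)^l / l.factorial = Real.exp (x * r ^ α) := by
        rw [Real.exp_eq_exp_ℝ, NormedSpace.exp_eq_tsum_div]
      rw [this, Real.norm_of_nonneg (by positivity), Real.rpow_one, mul_assoc, ← Real.exp_add, mul_left_comm,
        ← Real.exp_add]
      refine mul_le_mul_of_nonneg_left (Real.exp_le_exp.2 ?_) (by positivity)
      linarith [hM r hr]
  · filter_upwards [ae_restrict_mem measurableSet_Ioi] with r (hr : 0 < r)
    have h := NormedSpace.expSeries_div_hasSum_exp (-(((x * r^α : ℝ) : ℂ) * cexp (φ * I)))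
    rw [← Complex.exp_eq_exp_ℂ] at h
    have h2 := h.mul_left (((r ^ ((α-1)/2) : ℝ) : ℂ) * cexp (-(cexp (-φ * I) * r)))
    refine hsc (fun l => ?_) h2
    have e3 : (r:ℂ) ^ (((α * l + (1+α)/2 : ℝ):ℂ) - 1) = ((r ^ ((α-1)/2) : ℝ) : ℂ) * ((r ^ α : ℝ) : ℂ)^l := by
      rw [← Complex.ofReal_one, ← Complex.ofReal_sub, ← Complex.ofReal_cpow hr.le, ← Complex.ofReal_pow,
        ← Complex.ofReal_mul, ← Real.rpow_mul_natCast hr.le, ← Real.rpow_add hr]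
      congr 2; ring
    have e4 : cexp (φ * I * l) = cexp (φ * I) ^ l := by
      rw [← Complex.exp_nat_mul]; congr 1; ring
    have e5 : (-(((x * r^α : ℝ) : ℂ) * cexp (φ * I))) ^ l = (-(x:ℂ))^l * ((r ^ α : ℝ) : ℂ)^l * cexp (φ * I) ^ l := by
      rw [← mul_pow, ← mul_pow]; congr 1; push_cast; ring
    rw [e3, e4, e5]
    push_cast
    rw [one_mul]
    ring

lemma wright_eq {α x : ℝ} (h0 : 0 < α) (h1 : α < 1) (hx : 0 ≤ x) :
    ((wright (-α) ((1-α)/2) (-x) : ℝ) : ℂ) = 1/(2*Real.pi) * 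
      ((∫ r in Ioi (0:ℝ), Kf α (Real.pi * α/(1+α)) x r) + ∫ r in Ioi (0:ℝ), Kf α (-(Real.pi * α/(1+α))) x r) := by
  have hφ : |Real.pi * α/(1+α)| < Real.pi/2 := by
    rw [abs_of_pos (by positivity), div_lt_div_iff₀ (by positivity) (by positivity)]
    nlinarith [Real.pi_pos]
  have hφ' : |-(Real.pi * α/(1+α))| < Real.pi/2 := by rwa [abs_neg]
  have s := ((Jseries h0 h1 hφ hx).add (Jseries h0 h1 hφ' hx)).mul_left (1/(2*Real.pi) : ℂ)
  rw [← s.tsum_eq, wright, Complex.ofReal_tsum]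
  congr 1
  ext l
  set b : ℝ := α * l + (1+α)/2 with hb
  have hb0 : 0 < b := by positivity
  have hG := Real.Gamma_mul_Gamma_one_sub b
  have e1 : -α * l + (1-α)/2 = 1 - b := by rw [hb]; ring
  have e2 : (Real.Gamma (1-b))⁻¹ = Real.Gamma b * Real.sin (Real.pi * b) / Real.pi := by
    have hg : Real.Gamma (1-b) = (Real.Gamma b)⁻¹ * (Real.pi / Real.sin (Real.pi * b)) := by
      rw [← hG, inv_mul_cancel_left₀ (Real.Gamma_pos_of_pos hb0).ne']
    rw [hg, mul_inv, inv_inv, inv_div, mul_div_assoc]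
  have e3 : (Real.sin (Real.pi * b) : ℂ) = 1/2 * (cexp ((Real.pi * α/(1+α) : ℝ) * I * l) * cexp (b * ((Real.pi * α/(1+α) : ℝ) * I)) +
     cexp ((-(Real.pi * α/(1+α)) : ℝ) * I * l) * cexp (b * ((-(Real.pi * α/(1+α)) : ℝ) * I))) := by
    have : Real.sin (Real.pi * b) = Real.cos (Real.pi * α * (l + 1/2)) := by
      rw [← Real.sin_add_pi_div_two]; congr 1; rw [hb]; ring
    rw [this, Complex.ofReal_cos, Complex.cos, ← Complex.exp_add, ← Complex.exp_add]
    have ha : (1 + α : ℂ) ≠ 0 := by exact_mod_cast (by positivity : 1 + α ≠ 0)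
    have : (((Real.pi * α * (l + 1/2) : ℝ) : ℂ)) * I = (Real.pi * α/(1+α) : ℝ) * I * l + b * ((Real.pi * α/(1+α) : ℝ) * I) := by
      rw [hb]; push_cast; field_simp; ring
    rw [← this]
    have h2 : -(((Real.pi * α * (l + 1/2) : ℝ) : ℂ)) * I = (-(Real.pi * α/(1+α)) : ℝ) * I * l + b * ((-(Real.pi * α/(1+α)) : ℝ) * I) := by
      rw [neg_mul, this]; push_cast; ring
    rw [← h2]; ring
  have e4 : (-x) ^ l / (l.factorial * Real.Gamma (1-b)) = (-x)^l / l.factorial * (Real.Gamma b * Real.sin (Real.pi * b) / Real.pi) := by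
    rw [← e2]; field_simp
  rw [e1, e4, Complex.ofReal_mul, Complex.ofReal_div (_ * _), Complex.ofReal_mul (Real.Gamma b), e3, Complex.Gamma_ofReal]
  ring

lemma Kf_split (α φ c τ : ℝ) (t r : ℝ) :
    cexp (τ * Real.log t * I) * Kf α φ (c * t^2) r = 
    (((r ^ ((α-1)/2) : ℝ) : ℂ) * cexp (-(cexp (-φ * I) * r))) * 
      (cexp (τ * Real.log t * I) * cexp (-(((c * r^α : ℝ) : ℂ) * cexp (φ * I) * t^2))) := by
  unfold Kf
  have : (((c * t^2 * r^α : ℝ) : ℂ) * cexp (φ * I)) = ((c * r^α : ℝ) : ℂ) * cexp (φ * I) * t^2 := by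
    push_cast; ring
  rw [this]; ring

lemma norm_ph (τ s : ℝ) : ‖cexp (τ * s * I)‖ = 1 := by
  rw [← Complex.ofReal_mul, Complex.norm_exp_ofReal_mul_I]

lemma Kf_int {α φ c : ℝ} (h0 : 0 < α) (hφ : |φ| < Real.pi/2) (hc : 0 < c) (τ : ℝ) :
    Integrable (Function.uncurry fun t r : ℝ => cexp (τ * Real.log t * I) * Kf α φ (c * t^2) r)
      ((volume.restrict (Ioi (0:ℝ))).prod (volume.restrict (Ioi (0:ℝ)))) := by
  have hcos := cos_pos' hφ
  have hm : Measurable (Function.uncurry fun t r : ℝ => cexp (τ * Real.log t * I) * Kf α φ (c * t^2) r) := by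
    unfold Function.uncurry Kf
    fun_prop
  have hn : ∀ t r : ℝ, 0 < r → ‖cexp (τ * Real.log t * I) * Kf α φ (c * t^2) r‖ = 
      (r ^ ((α-1)/2) * Real.exp (-(Real.cos φ) * r)) * Real.exp (-(c * r^α * Real.cos φ) * t^2) := by
    intro t r hr
    rw [norm_mul, norm_ph, one_mul, Kf_norm _ _ _ hr]
    congr 2; ring
  rw [integrable_prod_iff' hm.aestronglyMeasurable]
  constructor
  · filter_upwards [ae_restrict_mem measurableSet_Ioi] with r (hr : 0 < r)
    have hA : 0 < c * r^α * Real.cos φ := by positivity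
    refine Integrable.mono' (((integrable_exp_neg_mul_sq hA).restrict (s := Ioi 0)).const_mul (r ^ ((α-1)/2) * Real.exp (-(Real.cos φ) * r))) ?_ ?_
    · exact (hm.comp (measurable_id.prodMk measurable_const)).aestronglyMeasurable
    · filter_upwards with t
      exact (hn t r hr).le
  · have hi := integrableOn_rpow_mul_exp_neg_mul_rpow (p := 1) (s := -(1/2)) (b := Real.cos φ) (by norm_num) one_pos hcos
    refine (hi.const_mul (√(Real.pi / (c * Real.cos φ)) / 2)).congr ?_
    filter_upwards [ae_restrict_mem measurableSet_Ioi] with r (hr : 0 < r)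
    simp only [Function.uncurry]
    simp_rw [hn _ r hr]
    rw [integral_const_mul, integral_gaussian_Ioi, Real.rpow_one]
    have e1 : Real.pi / (c * r ^ α * Real.cos φ) = Real.pi / (c * Real.cos φ) * (r ^ (-(α/2)))^2 := by
      rw [← Real.rpow_mul_natCast hr.le]
      have : -(α/2) * ((2:ℕ):ℝ) = -α := by push_cast; ring
      rw [this, Real.rpow_neg hr.le]
      field_simp
    have e2 : r ^ (-(1/2) : ℝ) = r ^ ((α-1)/2) * r ^ (-(α/2)) := by
      rw [← Real.rpow_add hr]; congr 1; ring
    rw [e1, Real.sqrt_mul (by positivity), Real.sqrt_sq (by positivity), e2]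
    ring

lemma Kf_mellin {α φ c : ℝ} (h0 : 0 < α) (hφ : |φ| < Real.pi/2) (hc : 0 < c) (τ : ℝ) :
    ∫ t in Ioi (0:ℝ), cexp (τ * Real.log t * I) * ∫ r in Ioi (0:ℝ), Kf α φ (c * t^2) r = 
    1/2 * Gamma ((1+τ*I)/2) * cexp (-((1+τ*I)/2 * Real.log c)) * Gamma ((1-α*τ*I)/2) * cexp (φ*τ*(1+α)/2) := by
  have hφ' : |-φ| < Real.pi/2 := by rwa [abs_neg]
  simp_rw [← integral_const_mul]
  rw [integral_integral_swap (Kf_int h0 hφ hc τ)]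
  have step : ∀ r ∈ Ioi (0:ℝ), ∫ t in Ioi (0:ℝ), cexp (τ * Real.log t * I) * Kf α φ (c * t^2) r = 
     (1/2 * Gamma ((1+τ*I)/2) * cexp (-((1+τ*I)/2 * (Real.log c + φ * I)))) * 
       ((r:ℂ) ^ ((1-α*τ*I)/2 - 1) * cexp (-(((1:ℝ):ℂ) * cexp ((-φ:ℝ) * I) * r))) := by
    intro r (hr : 0 < r)
    simp_rw [Kf_split]
    rw [integral_const_mul, gaussM (by positivity) hφ]
    have hr' : (r:ℂ) ≠ 0 := by exact_mod_cast hr.ne'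
    rw [Complex.cpow_def_of_ne_zero hr', Real.rpow_def_of_pos hr, Complex.ofReal_exp, Real.log_mul hc.ne' (by positivity),
      Real.log_rpow hr, ← Complex.ofReal_log hr.le]
    have : cexp ((Real.log r * ((α-1)/2) : ℝ)) * cexp (-((1+τ*I)/2 * ((Real.log c + α * Real.log r : ℝ) + φ * I))) = 
       cexp (-((1+τ*I)/2 * (Real.log c + φ * I))) * cexp (Real.log r * ((1-α*τ*I)/2 - 1)) := by
      rw [← Complex.exp_add, ← Complex.exp_add]; congr 1; push_cast; ring
    have h3 : cexp (-(((1:ℝ):ℂ) * cexp ((-φ:ℝ) * I) * r)) = cexp (-(cexp (-φ * I) * r)) := by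
      push_cast; rw [one_mul]
    rw [h3]
    linear_combination (1/2 * Gamma ((1+τ*I)/2) * cexp (-(cexp (-φ * I) * r))) * this
  rw [setIntegral_congr_fun measurableSet_Ioi step, integral_const_mul, pol one_pos hφ' (by simp)]
  have : cexp (-((1+τ*I)/2 * (Real.log c + φ * I))) * cexp (-((1-α*τ*I)/2 * (Real.log 1 + (-φ:ℝ) * I))) = 
     cexp (-((1+τ*I)/2 * Real.log c)) * cexp (φ*τ*(1+α)/2) := by
    rw [← Complex.exp_add, ← Complex.exp_add, Real.log_one]; congr 1; push_cast
    linear_combination (-φ*τ*(1+α)/2 : ℂ) * Complex.I_sq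
  linear_combination (1/2 * Gamma ((1+τ*I)/2) * Gamma ((1-α*τ*I)/2)) * this

/-- the density -/
noncomputable def rho (α t : ℝ) : ℝ :=
  (2 : ℝ) ^ ((α + 1) / 2) * wright (-α) ((1 - α) / 2) (-((2 : ℝ) ^ (α - 1) * t ^ 2))

/-- characteristic function of log |U| -/
noncomputable def gU (τ : ℝ) : ℂ := cexp (τ * Real.log 2 * I / 2) * Gamma ((1+τ*I)/2) / √Real.pi

lemma angle_lt {α : ℝ} (h0 : 0 < α) (h1 : α < 1) : |Real.pi * α/(1+α)| < Real.pi/2 := by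
  rw [abs_of_pos (by positivity), div_lt_div_iff₀ (by positivity) (by positivity)]
  nlinarith [Real.pi_pos]

lemma rho_eq {α : ℝ} (h0 : 0 < α) (h1 : α < 1) (τ t : ℝ) :
    (rho α t : ℂ) * cexp (τ * Real.log t * I) = (((2:ℝ) ^ ((α + 1) / 2) / (2*Real.pi) : ℝ) : ℂ) *
     (cexp (τ * Real.log t * I) * (∫ r in Ioi (0:ℝ), Kf α (Real.pi * α/(1+α)) ((2 : ℝ) ^ (α - 1) * t ^ 2) r) +
      cexp (τ * Real.log t * I) * ∫ r in Ioi (0:ℝ), Kf α (-(Real.pi * α/(1+α))) ((2 : ℝ) ^ (α - 1) * t ^ 2) r) := by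
  rw [rho, Complex.ofReal_mul, wright_eq h0 h1 (by positivity)]
  push_cast
  ring

lemma Kf_int1 {α φ c : ℝ} (h0 : 0 < α) (hφ : |φ| < Real.pi/2) (hc : 0 < c) (τ : ℝ) :
    IntegrableOn (fun t : ℝ => cexp (τ * Real.log t * I) * ∫ r in Ioi (0:ℝ), Kf α φ (c * t^2) r) (Ioi 0) := by
  have := (Kf_int h0 hφ hc τ).integral_prod_left
  simp only [Function.uncurry, integral_const_mul] at this
  exact this

lemma rho_int {α : ℝ} (h0 : 0 < α) (h1 : α < 1) : IntegrableOn (rho α) (Ioi 0) := by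
  have hφ := angle_lt h0 h1
  have hφ' : |-(Real.pi * α/(1+α))| < Real.pi/2 := by rwa [abs_neg]
  have hc : (0:ℝ) < 2 ^ (α - 1) := by positivity
  have := ((Kf_int1 h0 hφ hc 0).add (Kf_int1 h0 hφ' hc 0)).const_mul (((2:ℝ) ^ ((α + 1) / 2) / (2*Real.pi) : ℝ) : ℂ)
  have h2 : Integrable (fun t => (rho α t : ℂ)) (volume.restrict (Ioi 0)) := by
    refine this.congr (Eventually.of_forall fun t => ?_)
    have := rho_eq h0 h1 0 t
    simp only [Pi.add_apply]
    rw [← this]; simp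
  have h3 := h2.re
  simp only [RCLike.re_to_complex, Complex.ofReal_re] at h3
  exact h3

lemma rho_mellin {α : ℝ} (h0 : 0 < α) (h1 : α < 1) (τ : ℝ) : 
    (∫ t in Ioi (0:ℝ), (rho α t : ℂ) * cexp (τ * Real.log t * I)) * gU (α * τ) = gU τ := by
  have hφ := angle_lt h0 h1
  have hφ' : |-(Real.pi * α/(1+α))| < Real.pi/2 := by rwa [abs_neg]
  have hc : (0:ℝ) < 2 ^ (α - 1) := by positivity
  simp_rw [rho_eq h0 h1]
  rw [integral_const_mul, integral_add (Kf_int1 h0 hφ hc τ) (Kf_int1 h0 hφ' hc τ), Kf_mellin h0 hφ hc, Kf_mellin h0 hφ' hc]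
  have hpi : (Real.pi : ℂ) ≠ 0 := by exact_mod_cast Real.pi_ne_zero
  have ha : (1 + α : ℂ) ≠ 0 := by exact_mod_cast (by positivity : 1 + α ≠ 0)
  have hG := Complex.Gamma_mul_Gamma_one_sub ((1 + α * τ * I)/2)
  have e1 : 1 - (1 + α * τ * I)/2 = (1 - α * τ * I)/2 := by ring
  have e2 : Complex.sin (Real.pi * ((1 + α * τ * I)/2)) = Complex.cosh (Real.pi * α * τ / 2) := by
    have : Real.pi * ((1 + α * τ * I)/2) = (Real.pi * α * τ / 2) * I + Real.pi/2 := by ring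
    rw [this, Complex.sin_add_pi_div_two, Complex.cos_mul_I]
  have hch : Complex.cosh (Real.pi * α * τ / 2) ≠ 0 := by
    have : Complex.cosh (Real.pi * α * τ / 2) = (Real.cosh (Real.pi * α * τ / 2) : ℝ) := by push_cast; rfl
    rw [this]; exact_mod_cast (Real.cosh_pos _).ne'
  have e3 : cexp (((Real.pi * α/(1+α) : ℝ) : ℂ)*τ*(1+α)/2) + cexp (((-(Real.pi * α/(1+α)) : ℝ) : ℂ)*τ*(1+α)/2) = 
      2 * Complex.cosh (Real.pi * α * τ / 2) := by
    rw [Complex.cosh]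
    have a1 : ((Real.pi * α/(1+α) : ℝ) : ℂ)*τ*(1+α)/2 = Real.pi * α * τ / 2 := by push_cast; field_simp
    have a2 : ((-(Real.pi * α/(1+α)) : ℝ) : ℂ)*τ*(1+α)/2 = -(Real.pi * α * τ / 2) := by rw [← a1]; push_cast; ring
    rw [a1, a2]; ring
  rw [e1, e2, eq_div_iff hch] at hG
  have e4 : (((2:ℝ) ^ ((α + 1) / 2) : ℝ) : ℂ) * cexp (-((1+τ*I)/2 * Real.log (2 ^ (α-1)))) * cexp ((α*τ:ℝ) * Real.log 2 * I / 2)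
      = 2 * cexp (τ * Real.log 2 * I / 2) := by
    have : (2:ℂ) = cexp (Real.log 2 : ℝ) := by rw [← Complex.ofReal_exp, Real.exp_log two_pos]; simp
    have h6 : 2 * cexp (τ * Real.log 2 * I / 2) = cexp (Real.log 2 : ℝ) * cexp (τ * Real.log 2 * I / 2) := by rw [← this]
    rw [h6, Real.rpow_def_of_pos two_pos, Real.log_rpow two_pos, Complex.ofReal_exp, ← Complex.exp_add, ← Complex.exp_add, ← Complex.exp_add]
    congr 1; push_cast; ring
  unfold gU
  have e5 : ((α*τ:ℝ):ℂ) = α * τ := by push_cast; rfl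
  rw [e5] at e4 ⊢
  rw [Complex.ofReal_div]
  set E1 := cexp (((Real.pi * α/(1+α) : ℝ) : ℂ)*τ*(1+α)/2)
  set E2 := cexp (((-(Real.pi * α/(1+α)) : ℝ) : ℂ)*τ*(1+α)/2)
  set G1 := Gamma ((1 + α * τ * I)/2)
  set G2 := Gamma ((1 - α * τ * I)/2)
  set G := Gamma ((1 + τ * I)/2)
  set C := (((2:ℝ) ^ ((α + 1) / 2) : ℝ) : ℂ)
  set X := cexp (-((1+τ*I)/2 * Real.log (2 ^ (α-1))))
  set Y := cexp (α*τ * Real.log 2 * I / 2)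
  set Z := cexp (τ * Real.log 2 * I / 2)
  have h2pi : ((2 * Real.pi : ℝ) : ℂ) = 2 * Real.pi := by push_cast; rfl
  rw [h2pi]
  have hs : ((√Real.pi : ℝ) : ℂ) ≠ 0 := by exact_mod_cast (Real.sqrt_pos.2 Real.pi_pos).ne'
  calc _ = (C * X * Y) * G * (G1 * G2 * ((E1 + E2)/2)) / (2 * Real.pi) / (√Real.pi : ℝ) := by ring
    _ = _ := by
      have : (E1 + E2) / 2 = Complex.cosh (Real.pi * α * τ / 2) := by rw [e3]; ring
      rw [e4, this, hG]; field_simp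

lemma gU_zero : gU 0 = 1 := by
  unfold gU
  have hs : ((√Real.pi : ℝ) : ℂ) ≠ 0 := by exact_mod_cast (Real.sqrt_pos.2 Real.pi_pos).ne'
  have : Gamma (1/2) = (√Real.pi : ℝ) := by
    have := Real.Gamma_one_half_eq
    rw [← this, ← Complex.Gamma_ofReal]; norm_num
  simp only [Complex.ofReal_zero, zero_mul, zero_div, add_zero, this, Complex.exp_zero, one_mul, div_self hs]

lemma int_abs {f : ℝ → ℂ} (hf : Integrable (fun x : ℝ => f |x|)) : ∫ x, f |x| = 2 * ∫ x in Ioi (0:ℝ), f x := by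
  have e1 : ∫ x in Ioi (0:ℝ), f |x| = ∫ x in Ioi (0:ℝ), f x :=
    setIntegral_congr_fun measurableSet_Ioi (fun x (hx : 0 < x) => by simp only [abs_of_pos hx])
  have e2 : ∫ x in Iic (0:ℝ), f |x| = ∫ x in Ioi (0:ℝ), f x := by
    rw [← neg_zero, ← integral_comp_neg_Iic, neg_zero]
    exact setIntegral_congr_fun measurableSet_Iic (fun x (hx : x ≤ 0) => by simp only [abs_of_nonpos hx])
  rw [← intervalIntegral.integral_Iic_add_Ioi (b := 0) hf.integrableOn hf.integrableOn, e1, e2, two_mul]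

lemma charU (τ : ℝ) : ∫ u, cexp (τ * Real.log |u| * I) ∂(gaussianReal 0 1) = gU τ := by
  rw [integral_gaussianReal_eq_integral_smul one_ne_zero]
  have h1 : ∀ u : ℝ, gaussianPDFReal 0 1 u • cexp (τ * Real.log |u| * I) = 
      (fun v : ℝ => (((√(2 * Real.pi))⁻¹ : ℝ) : ℂ) * (cexp (τ * Real.log v * I) * cexp (-(((1/2:ℝ):ℂ) * cexp ((0:ℝ) * I) * v^2)))) |u| := by
    intro u
    rw [gaussianPDFReal, Complex.real_smul]
    have : ((|u| : ℝ) : ℂ)^2 = (u:ℂ)^2 := by rw [← Complex.ofReal_pow, sq_abs, Complex.ofReal_pow]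
    simp only [this]
    push_cast
    have h3 : (-((u:ℂ) - 0)^2 / (2 * 1)) = -(1/2 * cexp (0 * I) * u^2) := by simp; ring
    simp only [Complex.ofReal_zero, NNReal.coe_one, mul_one] 
    rw [mul_assoc, mul_comm (cexp _)]
    congr 2
    congr 1
    simp; ring
  have hi : Integrable (fun u : ℝ => gaussianPDFReal 0 1 u • cexp (τ * Real.log |u| * I)) := by
    refine (integrable_gaussianPDFReal 0 1).mono' ?_ ?_
    · apply Measurable.aestronglyMeasurable; fun_prop
    · filter_upwards with u
      rw [norm_smul, norm_ph, mul_one, Real.norm_of_nonneg (gaussianPDFReal_nonneg _ _ _)]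
  rw [funext h1] at hi ⊢
  refine (int_abs (f := fun v : ℝ => (((√(2 * Real.pi))⁻¹ : ℝ) : ℂ) * (cexp (τ * Real.log v * I) * cexp (-(((1/2:ℝ):ℂ) * cexp ((0:ℝ) * I) * v^2)))) hi).trans ?_
  rw [integral_const_mul, gaussM (by norm_num) (by simp [Real.pi_pos])]
  unfold gU
  have e1 : cexp (-((1+τ*I)/2 * (Real.log (1/2) + (0:ℝ) * I))) = (√2 : ℝ) * cexp (τ * Real.log 2 * I / 2) := by
    have : √2 = Real.exp (Real.log 2 / 2) := by
      rw [Real.exp_half, Real.exp_log two_pos]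
    rw [this, one_div, Real.log_inv, Complex.ofReal_exp, ← Complex.exp_add]
    congr 1; push_cast; ring
  rw [e1, Real.sqrt_mul two_pos.le]
  have hs : ((√Real.pi : ℝ) : ℂ) ≠ 0 := by exact_mod_cast (Real.sqrt_pos.2 Real.pi_pos).ne'
  have hs2 : ((√2 : ℝ) : ℂ) ≠ 0 := by exact_mod_cast (Real.sqrt_pos.2 two_pos).ne'
  push_cast
  field_simp

theorem abs_gaussian_mult_self_decomposition
    {Ω : Type*} [MeasurableSpace Ω] (μ : Measure Ω) [IsProbabilityMeasure μ]
    (α : ℝ) (hα0 : 0 < α) (hα1 : α < 1)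
    (U X : Ω → ℝ) (hU : Measurable U) (hX : Measurable X)
    (hindep : IndepFun U X μ)
    (hlawU : μ.map U = gaussianReal 0 1)
    (hlawX : μ.map X =
      (volume.restrict (Ioi (0 : ℝ))).withDensity
        (fun t => ENNReal.ofReal
          ((2 : ℝ) ^ ((α + 1) / 2) *
            wright (-α) ((1 - α) / 2) (-((2 : ℝ) ^ (α - 1) * t ^ 2))))) :
    μ.map (fun ω => |U ω|) = μ.map (fun ω => |U ω| ^ α * X ω) := by
  change μ.map X = (volume.restrict (Ioi (0 : ℝ))).withDensity (fun t => ENNReal.ofReal (rho α t)) at hlawX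
  have hri := rho_int hα0 hα1
  have hgne : gU 0 = 1 := gU_zero
  -- nonnegativity of the density
  have htot : ∫⁻ t in Ioi (0:ℝ), ENNReal.ofReal (rho α t) = 1 := by
    have h : (μ.map X) univ = 1 := by
      rw [Measure.map_apply hX MeasurableSet.univ]; simp
    rw [hlawX, withDensity_apply _ MeasurableSet.univ, Measure.restrict_univ] at h
    exact h
  have hint1 : ∫ t in Ioi (0:ℝ), rho α t = 1 := by
    have h := rho_mellin hα0 hα1 0
    rw [mul_zero, hgne, mul_one] at h
    simp only [Complex.ofReal_zero, zero_mul, Complex.exp_zero, mul_one] at h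
    rw [integral_complex_ofReal] at h
    exact_mod_cast h
  have hnn : ∀ᵐ t ∂(volume.restrict (Ioi (0:ℝ))), 0 ≤ rho α t := by
    have h := integral_eq_lintegral_pos_part_sub_lintegral_neg_part hri
    rw [hint1, htot, ENNReal.toReal_one] at h
    have h0 : (∫⁻ t in Ioi (0:ℝ), ENNReal.ofReal (-rho α t)).toReal = 0 := by linarith
    rw [ENNReal.toReal_eq_zero_iff] at h0
    have hfin : ∫⁻ t in Ioi (0:ℝ), ENNReal.ofReal (-rho α t) ≠ ⊤ := hri.neg.lintegral_lt_top.ne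
    have h1 := h0.resolve_right hfin
    have h1 := (lintegral_eq_zero_iff' hri.neg.aemeasurable.ennreal_ofReal).1 h1
    filter_upwards [h1] with t ht
    simpa using ht
  -- positivity a.s.
  have hXpos : ∀ᵐ ω ∂μ, 0 < X ω := by
    have : ∀ᵐ x ∂(μ.map X), 0 < x := by
      rw [hlawX]
      exact (withDensity_absolutelyContinuous _ _) (ae_restrict_mem measurableSet_Ioi)
    exact ae_of_ae_map hX.aemeasurable this
  have hUne : ∀ᵐ ω ∂μ, U ω ≠ 0 := by
    have : ∀ᵐ x ∂(μ.map U), x ≠ 0 := by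
      rw [hlawU]
      exact (gaussianReal_absolutelyContinuous 0 one_ne_zero) (Measure.ae_ne volume 0)
    exact ae_of_ae_map hU.aemeasurable this
  -- characteristic functions
  have hL : Measurable (fun ω => Real.log |U ω|) := by fun_prop
  have hLX : Measurable (fun ω => Real.log (X ω)) := by fun_prop
  have hLα : Measurable (fun ω => α * Real.log |U ω|) := by fun_prop
  have cU : ∀ τ : ℝ, ∫ ω, cexp (τ * (Real.log |U ω| : ℝ) * I) ∂μ = gU τ := by
    intro τ
    rw [← charU τ, ← hlawU, integral_map hU.aemeasurable]
    apply Measurable.aestronglyMeasurable; fun_prop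
  have cX : ∀ τ : ℝ, ∫ ω, cexp (τ * (Real.log (X ω) : ℝ) * I) ∂μ = ∫ t in Ioi (0:ℝ), (rho α t : ℂ) * cexp (τ * Real.log t * I) := by
    intro τ
    have hm : Measurable (fun x : ℝ => cexp (τ * (Real.log x : ℝ) * I)) := by fun_prop
    rw [← integral_map (f := fun x : ℝ => cexp (τ * (Real.log x : ℝ) * I)) hX.aemeasurable hm.aestronglyMeasurable, hlawX,
      integral_withDensity_eq_integral_toReal_smul₀ hri.aemeasurable.ennreal_ofReal (by simp)]
    apply integral_congr_ae
    filter_upwards [hnn] with t ht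
    rw [ENNReal.toReal_ofReal ht, Complex.real_smul]
  have hlog : μ.map (fun ω => Real.log |U ω|) = μ.map ((fun ω => α * Real.log |U ω|) + fun ω => Real.log (X ω)) := by
    have := Measure.isProbabilityMeasure_map (μ := μ) hL.aemeasurable
    have := Measure.isProbabilityMeasure_map (μ := μ) (hLα.add hLX).aemeasurable
    apply Measure.ext_of_charFun
    have hind : IndepFun (fun ω => α * Real.log |U ω|) (fun ω => Real.log (X ω)) μ :=
      hindep.comp (φ := fun u => α * Real.log |u|) (ψ := fun x => Real.log x) (by fun_prop) (by fun_prop)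
    rw [hind.charFun_map_add_eq_mul hLα.aemeasurable hLX.aemeasurable]
    ext τ
    rw [Pi.mul_apply, charFun_apply_real, charFun_apply_real, charFun_apply_real,
      integral_map hL.aemeasurable (Measurable.aestronglyMeasurable (by fun_prop)),
      integral_map hLα.aemeasurable (Measurable.aestronglyMeasurable (by fun_prop)),
      integral_map hLX.aemeasurable (Measurable.aestronglyMeasurable (by fun_prop)), cU, cX, 
      ← rho_mellin hα0 hα1 τ, mul_comm, ← cU (α * τ)]
    congr 2
    ext ω
    congr 1
    push_cast
    ring
  have h2 := congrArg (fun ν => Measure.map Real.exp ν) hlog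
  rw [Measure.map_map (by fun_prop) hL, Measure.map_map (by fun_prop) (hLα.add hLX)] at h2
  have e1 : μ.map (fun ω => |U ω|) = μ.map (Real.exp ∘ fun ω => Real.log |U ω|) := by
    apply Measure.map_congr
    filter_upwards [hUne] with ω h
    simp only [Function.comp]
    rw [Real.exp_log (abs_pos.2 h)]
  have e2 : μ.map (fun ω => |U ω| ^ α * X ω) = μ.map (Real.exp ∘ ((fun ω => α * Real.log |U ω|) + fun ω => Real.log (X ω))) := by
    apply Measure.map_congr
    filter_upwards [hUne, hXpos] with ω h hx
    simp only [Function.comp, Pi.add_apply]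
    rw [Real.exp_add, Real.exp_log hx, Real.rpow_def_of_pos (abs_pos.2 h), mul_comm α]
  rw [e1, e2, h2]
end

section
/- Let 0 < α < 1 and let U be a symmetric real random variable with continuous density on ℝ whose Mellin transform of |U| exists for Re(s) > 0. If |U| has the same distribution as |U|^α · X_α, where X_α is independent of U with density 2^((α+1)/2) W_{-α,(1-α)/2}(-2^(α-1)t²), then U is standard normal. -/
open MeasureTheory Set ProbabilityTheory

open Filter
open Filter Topology in
theorem gr_integrable {a r : ℂ} (ha : 0 < a.re) (hr : 0 < r.re) :
    IntegrableOn (fun t : ℝ => (t : ℂ) ^ (a - 1) * Complex.exp (-(r * t))) (Ioi 0) := by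
  have h := integrableOn_rpow_mul_exp_neg_mul_rpow (p := 1) (s := a.re - 1) (b := r.re)
    (by linarith) one_pos hr
  refine Integrable.mono' h ?_ ?_
  · refine ContinuousOn.aestronglyMeasurable ?_ measurableSet_Ioi
    refine ContinuousOn.mul ?_ (by fun_prop)
    intro t ht
    exact (Complex.continuousAt_ofReal_cpow_const _ _ (Or.inr (ne_of_gt ht))).continuousWithinAt
  · refine (ae_restrict_mem measurableSet_Ioi).mono fun t ht => ?_
    rw [norm_mul, Complex.norm_cpow_eq_rpow_re_of_pos ht, Complex.norm_exp]
    simp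

theorem gr_deriv {a r : ℂ} (ha : 0 < a.re) (hr : 0 < r.re) :
    DifferentiableAt ℂ (fun r : ℂ => ∫ t : ℝ in Ioi 0, (t : ℂ) ^ (a - 1) * Complex.exp (-(r * t)))
      r := by
  have hδ : 0 < r.re / 2 := by linarith
  have hb := integrableOn_rpow_mul_exp_neg_mul_rpow (p := 1) (s := a.re) (b := r.re / 2)
    (by linarith) one_pos hδ
  refine (hasDerivAt_integral_of_dominated_loc_of_deriv_le (μ := volume.restrict (Ioi (0:ℝ)))
    (F := fun (r : ℂ) (t : ℝ) => (t : ℂ) ^ (a - 1) * Complex.exp (-(r * t)))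
    (F' := fun (r : ℂ) (t : ℝ) => (t : ℂ) ^ (a - 1) * (Complex.exp (-(r * t)) * (-t)))
    (bound := fun t => t ^ a.re * Real.exp (-(r.re / 2) * t ^ (1:ℝ)))
    (Metric.ball_mem_nhds r hδ) ?_ (gr_integrable ha hr) ?_ ?_ hb ?_).2.differentiableAt
  · have : ∀ᶠ z : ℂ in nhds r, 0 < z.re :=
      (Complex.continuous_re.isOpen_preimage _ isOpen_Ioi).mem_nhds hr
    exact this.mono fun z hz => (gr_integrable ha hz).aestronglyMeasurable
  · refine ContinuousOn.aestronglyMeasurable ?_ measurableSet_Ioi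
    refine ContinuousOn.mul ?_ (by fun_prop)
    intro t ht
    exact (Complex.continuousAt_ofReal_cpow_const _ _ (Or.inr (ne_of_gt ht))).continuousWithinAt
  · refine (ae_restrict_mem measurableSet_Ioi).mono fun t ht z hz => ?_
    have ht : 0 < t := ht
    have hz' : r.re / 2 ≤ z.re := by
      have h1 : ‖z - r‖ < r.re / 2 := by simpa [dist_eq_norm] using hz
      have h2 := Complex.abs_re_le_norm (z - r)
      have h3 := (abs_le.1 h2).1
      simp at h3
      linarith
    rw [norm_mul, norm_mul, Complex.norm_cpow_eq_rpow_re_of_pos ht, Complex.norm_exp]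
    have e : ‖(-(t:ℂ))‖ = t := by simp [abs_of_pos ht]
    rw [e]
    have e2 : t ^ a.re = t ^ (a.re - 1) * t := by
      rw [Real.rpow_sub_one ht.ne']; field_simp
    have e3 : (a-1).re = a.re - 1 := by simp
    rw [e2, e3, mul_assoc, mul_comm t]
    gcongr
    simp
    nlinarith
  · refine (ae_restrict_mem measurableSet_Ioi).mono fun t ht z hz => ?_
    have h1 : HasDerivAt (fun z : ℂ => -(z * t)) (-(t:ℂ)) z := by
      simpa using ((hasDerivAt_id' z).mul_const (t:ℂ)).fun_neg
    exact h1.cexp.const_mul _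

open Filter Topology in
theorem gr_integral {a r : ℂ} (ha : 0 < a.re) (hr : 0 < r.re) :
    ∫ t : ℝ in Ioi 0, (t : ℂ) ^ (a - 1) * Complex.exp (-(r * t)) = r ^ (-a) * Complex.Gamma a := by
  let S : Set ℂ := {z | 0 < z.re}
  have hS : IsOpen S := Complex.continuous_re.isOpen_preimage _ isOpen_Ioi
  have hconv : IsPreconnected S := (convex_halfSpace_re_gt 0).isPreconnected
  have hf : AnalyticOnNhd ℂ
      (fun r : ℂ => ∫ t : ℝ in Ioi 0, (t : ℂ) ^ (a - 1) * Complex.exp (-(r * t))) S :=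
    DifferentiableOn.analyticOnNhd (fun z hz => (gr_deriv ha hz).differentiableWithinAt) hS
  have hg : AnalyticOnNhd ℂ (fun r : ℂ => r ^ (-a) * Complex.Gamma a) S := by
    refine DifferentiableOn.analyticOnNhd (fun z hz => ?_) hS
    refine DifferentiableAt.differentiableWithinAt ?_
    refine DifferentiableAt.mul_const ?_ _
    exact (differentiableAt_id).cpow_const (Or.inl hz)
  have h1 : (1:ℂ) ∈ S := by simp [S]
  refine hf.eqOn_of_preconnected_of_frequently_eq hg hconv h1 ?_ hr
  have hseq : Tendsto (fun n : ℕ => ((1 + 1 / ((n:ℝ) + 1) : ℝ) : ℂ)) atTop (𝓝[≠] 1) := by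
    refine tendsto_nhdsWithin_iff.2 ⟨?_, Eventually.of_forall fun n => ?_⟩
    · have := (tendsto_one_div_add_atTop_nhds_zero_nat (𝕜 := ℝ)).const_add 1
      have h2 := (Complex.continuous_ofReal.tendsto _).comp this
      simpa [Function.comp_def] using h2
    · simp only [mem_compl_iff, mem_singleton_iff]
      intro h
      have : (1 + 1 / ((n:ℝ) + 1) : ℝ) = 1 := by exact_mod_cast h
      have h3 : 0 < 1 / ((n:ℝ) + 1) := by positivity
      linarith
  refine hseq.frequently (Frequently.of_forall fun n => ?_)
  have hp : (0:ℝ) < 1 + 1 / ((n:ℝ) + 1) := by positivity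
  have := Complex.integral_cpow_mul_exp_neg_mul_Ioi ha hp
  refine this.trans ?_
  rw [one_div, Complex.inv_cpow _ _ (by rw [Complex.arg_ofReal_of_nonneg hp.le]; exact Real.pi_pos.ne), Complex.cpow_neg]

theorem re_exp_pos {φ : ℝ} (h : |φ| < Real.pi / 2) : 0 < (Complex.exp (φ * Complex.I)).re := by
  rw [Complex.exp_ofReal_mul_I_re]
  exact Real.cos_pos_of_mem_Ioo (abs_lt.1 h)

theorem exp_cpow {φ : ℝ} (h : |φ| < Real.pi / 2) (a : ℂ) :
    Complex.exp (φ * Complex.I) ^ a = Complex.exp (φ * Complex.I * a) := by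
  rw [Complex.cpow_def_of_ne_zero (Complex.exp_ne_zero _), Complex.log_exp]
  · simp; linarith [(abs_lt.1 h).1, Real.pi_pos]
  · simp; linarith [(abs_lt.1 h).2, Real.pi_pos]

noncomputable def Hfun (α β φ ψ x : ℝ) : ℂ :=
  ∫ r : ℝ in Ioi 0, (r : ℂ) ^ (-β : ℂ) * Complex.exp (-(Complex.exp (φ * Complex.I) * r)) *
    Complex.exp (-(Complex.exp (ψ * Complex.I) * ((x * r ^ α : ℝ) : ℂ)))

theorem Hfun_mellin {α β φ ψ : ℝ} (hφ : |φ| < Real.pi / 2)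
    (hψ : |ψ| < Real.pi / 2) {p : ℂ} (hp : 0 < p.re) (hp1 : 0 < 1 - β - α * p.re) :
    HasMellin (Hfun α β φ ψ) p (Complex.exp (-(ψ * Complex.I * p)) *
      Complex.exp (-(φ * Complex.I * (1 - β - α * p))) *
      (Complex.Gamma p * Complex.Gamma (1 - β - α * p))) := by
  set κ := Complex.exp (φ * Complex.I) with hκ
  set η := Complex.exp (ψ * Complex.I) with hη
  have hκr : 0 < κ.re := re_exp_pos hφ
  have hηr : 0 < η.re := re_exp_pos hψ
  let F : ℝ → ℝ → ℂ := fun x r => (x : ℂ) ^ (p - 1) * ((r : ℂ) ^ (-β : ℂ) * Complex.exp (-(κ * r)) *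
    Complex.exp (-(η * ((x * r ^ α : ℝ) : ℂ))))
  have hinner : ∀ r : ℝ, 0 < r → (fun x => F x r) = fun x : ℝ => ((r : ℂ) ^ (-β : ℂ) * Complex.exp (-(κ * r))) * ((x : ℂ) ^ (p - 1) *
      Complex.exp (-((η * (r ^ α : ℝ)) * x))) := by
    intro r hr
    funext x
    simp only [F]
    push_cast
    ring_nf
  have hre : ∀ r : ℝ, 0 < r → 0 < (η * (r ^ α : ℝ)).re := by
    intro r hr
    rw [Complex.re_mul_ofReal]
    have := Real.rpow_pos_of_pos hr α
    positivity
  have hmeas : AEStronglyMeasurable (Function.uncurry F)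
      ((volume.restrict (Ioi (0:ℝ))).prod (volume.restrict (Ioi (0:ℝ)))) := by
    refine Measurable.aestronglyMeasurable ?_
    simp only [F, Function.uncurry_def]
    fun_prop
  have hint : Integrable (Function.uncurry F)
      ((volume.restrict (Ioi (0:ℝ))).prod (volume.restrict (Ioi (0:ℝ)))) := by
    refine (integrable_prod_iff' hmeas).2 ⟨?_, ?_⟩
    · refine (ae_restrict_mem measurableSet_Ioi).mono fun r hr => ?_
      have := (gr_integrable hp (hre r hr)).const_mul ((r : ℂ) ^ (-β : ℂ) * Complex.exp (-(κ * r)))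
      simp only [Function.uncurry]
      rw [hinner r hr]
      exact this
    · have h := integrableOn_rpow_mul_exp_neg_mul_rpow (p := 1) (s := -β - α * p.re) (b := κ.re)
        (by linarith) one_pos hκr
      have h' := h.const_mul ((1 / η.re) ^ p.re * Real.Gamma p.re)
      refine h'.congr ?_
      refine (ae_restrict_mem measurableSet_Ioi).mono fun r hr => ?_
      have hr : 0 < r := hr
      simp only [Function.uncurry]
      have hra := Real.rpow_pos_of_pos hr α
      have hb : 0 < η.re * r ^ α := by positivity
      have h2 := Real.integral_rpow_mul_exp_neg_mul_Ioi hp hb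
      have h3 : ∫ x in Ioi (0:ℝ), ‖F x r‖ = ∫ x in Ioi (0:ℝ), (r ^ (-β) * Real.exp (-(κ.re * r))) *
          (x ^ (p.re - 1) * Real.exp (-(η.re * r ^ α * x))) := by
        refine setIntegral_congr_fun measurableSet_Ioi fun x hx => ?_
        have := congrFun (hinner r hr) x
        rw [this, norm_mul, norm_mul, norm_mul, Complex.norm_cpow_eq_rpow_re_of_pos hr,
          Complex.norm_cpow_eq_rpow_re_of_pos hx, Complex.norm_exp, Complex.norm_exp]
        simp
      rw [h3, integral_const_mul, h2]
      rw [one_div, one_div, mul_inv, Real.mul_rpow (by positivity) (by positivity), Real.inv_rpow hra.le,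
        ← Real.rpow_mul hr.le, sub_eq_add_neg, Real.rpow_add hr, Real.rpow_neg hr.le (α * p.re)]
      simp only [Real.rpow_one, neg_mul]
      ring
  refine ⟨?_, ?_⟩
  · have := hint.integral_prod_left
    refine (integrable_congr ?_).1 this
    refine Eventually.of_forall fun x => ?_
    simp only [Function.uncurry, F, Hfun, smul_eq_mul]
    rw [integral_const_mul]
  · have hsw := integral_integral_swap hint
    have e1 : mellin (Hfun α β φ ψ) p = ∫ x in Ioi (0:ℝ), ∫ r in Ioi (0:ℝ), F x r := by
      simp only [mellin, F, Hfun, smul_eq_mul, integral_const_mul]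
      rfl
    rw [e1, hsw]
    have e2 : ∫ r in Ioi (0:ℝ), ∫ x in Ioi (0:ℝ), F x r = ∫ r in Ioi (0:ℝ),
        (η ^ (-p) * Complex.Gamma p) * ((r:ℂ) ^ ((1 - β - α * p) - 1) * Complex.exp (-(κ * r))) := by
      refine setIntegral_congr_fun measurableSet_Ioi fun r hr => ?_
      have hr : 0 < r := hr
      rw [hinner r hr, integral_const_mul, gr_integral hp (hre r hr)]
      have hr0 : (r:ℂ) ≠ 0 := by exact_mod_cast hr.ne'
      have e3 : (η * (r ^ α : ℝ)) ^ (-p) = η ^ (-p) * (r:ℂ) ^ (-(α * p)) := by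
        rw [Complex.cpow_def_of_ne_zero, Complex.cpow_def_of_ne_zero (Complex.exp_ne_zero _),
          Complex.cpow_def_of_ne_zero hr0, ← Complex.exp_add,
          Complex.log_mul_ofReal _ (Real.rpow_pos_of_pos hr α) _ (Complex.exp_ne_zero _),
          Real.log_rpow hr, Complex.ofReal_mul, Complex.ofReal_log hr.le]
        · ring_nf
        · exact mul_ne_zero (Complex.exp_ne_zero _) (by exact_mod_cast (Real.rpow_pos_of_pos hr α).ne')
      have e4 : (r:ℂ) ^ ((1 - β - α * p) - 1) = (r:ℂ) ^ (-β : ℂ) * (r:ℂ) ^ (-(α * p)) := by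
        rw [← Complex.cpow_add _ _ hr0]
        ring_nf
      rw [e3, e4]
      ring
    rw [e2, integral_const_mul, gr_integral (by simpa using hp1) hκr, exp_cpow hφ, exp_cpow hψ]
    ring_nf

theorem bound_integrable {α β c x : ℝ} (hα1 : α < 1) (hα0 : 0 < α) (hβ : β < 1) (hc : 0 < c)
    (hx : 0 ≤ x) :
    IntegrableOn (fun r : ℝ => r ^ (-β) * Real.exp (-(c * r)) * Real.exp (x * r ^ α)) (Ioi 0) := by
  obtain ⟨K, hK⟩ : ∃ K : ℝ, ∀ r : ℝ, 0 < r → x * r ^ α ≤ c / 2 * r + K := by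
    have h2 := (tendsto_rpow_neg_atTop (sub_pos.2 hα1)).eventually_lt_const
      (show 0 < c / 2 / (x + 1) by positivity)
    obtain ⟨R, hR⟩ := eventually_atTop.1 h2
    refine ⟨x * (max R 1) ^ α, fun r hr => ?_⟩
    rcases le_total (max R 1) r with h3 | h3
    · have h4 := hR r ((le_max_left _ _).trans h3)
      replace h4 : r ^ α ≤ c / 2 / (x + 1) * r := by
        have e : r ^ α = r ^ (-(1 - α)) * r := by
          nth_rewrite 3 [← Real.rpow_one r]
          rw [← Real.rpow_add hr]; ring_nf
        rw [e]
        exact mul_le_mul_of_nonneg_right h4.le hr.le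
      have h5 : x * r ^ α ≤ (x + 1) * (c / 2 / (x + 1) * r) := by
        have := Real.rpow_nonneg hr.le α
        nlinarith
      have h6 : (x + 1) * (c / 2 / (x + 1) * r) = c / 2 * r := by field_simp
      have : 0 ≤ x * (max R 1) ^ α := by positivity
      linarith
    · have : r ^ α ≤ (max R 1) ^ α := Real.rpow_le_rpow hr.le h3 hα0.le
      have := mul_le_mul_of_nonneg_left this hx
      have : 0 < c / 2 * r := by positivity
      linarith
  have h := (integrableOn_rpow_mul_exp_neg_mul_rpow (p := 1) (s := -β) (b := c / 2)
    (by linarith) one_pos (by linarith)).const_mul (Real.exp K)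
  refine Integrable.mono' h ?_ ?_
  · refine Measurable.aestronglyMeasurable ?_
    fun_prop
  · refine (ae_restrict_mem measurableSet_Ioi).mono fun r hr => ?_
    have hr : 0 < r := hr
    have h1 := Real.rpow_nonneg hr.le (-β)
    rw [Real.norm_of_nonneg (by positivity), mul_assoc, ← Real.exp_add, Real.rpow_one, mul_left_comm,
      ← Real.exp_add]
    refine mul_le_mul_of_nonneg_left (Real.exp_le_exp.2 ?_) h1
    have := hK r hr
    linarith

theorem Hfun_hasSum {α β φ ψ : ℝ} (hα0 : 0 < α) (hα1 : α < 1) (hβ : β < 1)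
    (hφ : |φ| < Real.pi / 2) {x : ℝ} (hx : 0 ≤ x) :
    HasSum (fun l : ℕ => (-(x:ℂ)) ^ l / (l.factorial : ℂ) * Complex.exp (ψ * Complex.I * l) *
      (Complex.exp (-(φ * Complex.I * (1 - β + α * l))) * Complex.Gamma (1 - β + α * l)))
      (Hfun α β φ ψ x) := by
  unfold Hfun
  set κ := Complex.exp (φ * Complex.I) with hκ
  set η := Complex.exp (ψ * Complex.I) with hη
  have hκr : 0 < κ.re := re_exp_pos hφ
  have hηn : ‖η‖ = 1 := Complex.norm_exp_ofReal_mul_I ψ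
  have key := hasSum_integral_of_dominated_convergence (μ := volume.restrict (Ioi (0:ℝ)))
    (F := fun (l : ℕ) (r : ℝ) => (r : ℂ) ^ (-β : ℂ) * Complex.exp (-(κ * r)) *
      ((-(η * ((x * r ^ α : ℝ) : ℂ))) ^ l / (l.factorial : ℂ)))
    (f := fun r : ℝ => (r : ℂ) ^ (-β : ℂ) * Complex.exp (-(κ * r)) *
      Complex.exp (-(η * ((x * r ^ α : ℝ) : ℂ))))
    (fun l r => r ^ (-β) * Real.exp (-(κ.re * r)) * ((x * r ^ α) ^ l / (l.factorial : ℝ)))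
    ?_ ?_ ?_ ?_ ?_
  · convert! key using 1
    funext l
    have ha : 0 < (1 - (β:ℂ) + α * l).re := by
      have : 0 ≤ α * l := by positivity
      simp
      linarith
    have e : ∫ r in Ioi (0:ℝ), (r : ℂ) ^ (-β : ℂ) * Complex.exp (-(κ * r)) *
      ((-(η * ((x * r ^ α : ℝ) : ℂ))) ^ l / (l.factorial : ℂ)) = ∫ r in Ioi (0:ℝ),
        ((-(x:ℂ)) ^ l / (l.factorial : ℂ) * η ^ l) *
        ((r:ℂ) ^ ((1 - (β:ℂ) + α * l) - 1) * Complex.exp (-(κ * r))) := by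
      refine setIntegral_congr_fun measurableSet_Ioi fun r hr => ?_
      have hr : 0 < r := hr
      have hr0 : (r:ℂ) ≠ 0 := by exact_mod_cast hr.ne'
      have e1 : (r:ℂ) ^ ((1 - (β:ℂ) + α * l) - 1) = (r:ℂ) ^ (-β : ℂ) * ((r ^ α : ℝ) : ℂ) ^ l := by
        rw [Complex.ofReal_cpow hr.le, ← Complex.cpow_mul_nat, ← Complex.cpow_add _ _ hr0]
        ring_nf
      have e2 : (-(η * ((x * r ^ α : ℝ) : ℂ))) ^ l = (-(x:ℂ)) ^ l * η ^ l * ((r ^ α : ℝ) : ℂ) ^ l := by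
        rw [← mul_pow, ← mul_pow, Complex.ofReal_mul]
        ring_nf
      rw [e1, e2]
      ring
    rw [e, integral_const_mul, gr_integral ha hκr, exp_cpow hφ, ← Complex.exp_nat_mul]
    ring_nf
  · intro l
    refine Measurable.aestronglyMeasurable ?_
    fun_prop
  · intro l
    refine (ae_restrict_mem measurableSet_Ioi).mono fun r hr => ?_
    have hr : 0 < r := hr
    have h0 : 0 ≤ x * r ^ α := mul_nonneg hx (Real.rpow_nonneg hr.le _)
    rw [norm_mul, norm_mul, norm_div, norm_pow, norm_neg, norm_mul, hηn,
      Complex.norm_cpow_eq_rpow_re_of_pos hr, Complex.norm_exp, Complex.norm_of_nonneg h0]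
    simp
  · refine Eventually.of_forall fun r => ?_
    exact (Real.summable_pow_div_factorial _).mul_left _
  · refine (integrable_congr ?_).1 (bound_integrable hα1 hα0 hβ hκr hx)
    refine Eventually.of_forall fun r => ?_
    simp only
    rw [tsum_mul_left, Real.exp_eq_exp_ℝ, NormedSpace.exp_eq_tsum_div]
  · refine Eventually.of_forall fun r => ?_
    refine HasSum.mul_left _ ?_
    rw [Complex.exp_eq_exp_ℂ]
    exact NormedSpace.expSeries_div_hasSum_exp _

theorem rgamma_eq {s : ℝ} (hs : s < 1) :
    (1:ℂ) / (Real.Gamma s : ℂ) = Complex.Gamma (1 - s) *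
      ((Complex.exp (Real.pi * s * Complex.I) - Complex.exp (-(Real.pi * s * Complex.I))) / (2 * Real.pi * Complex.I)) := by
  have h := Complex.Gamma_mul_Gamma_one_sub (s:ℂ)
  have hg : Complex.Gamma (1 - s) ≠ 0 := by
    apply Complex.Gamma_ne_zero_of_re_pos
    simpa using hs
  have hpi : (Real.pi : ℂ) ≠ 0 := by exact_mod_cast Real.pi_pos.ne'
  have hsin : (Complex.exp (Real.pi * s * Complex.I) - Complex.exp (-(Real.pi * s * Complex.I))) / (2 * Real.pi * Complex.I) = Complex.sin (Real.pi * s) / Real.pi := by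
    rw [Complex.sin]
    field_simp
    rw [Complex.I_sq]
    ring_nf
  rw [hsin, ← Complex.Gamma_ofReal]
  by_cases h0 : Complex.sin (Real.pi * s) = 0
  · rw [h0, div_zero] at h
    have := (mul_eq_zero.1 h).resolve_right hg
    rw [this, h0]; simp
  · have h1 : Complex.Gamma (s:ℂ) ≠ 0 := by
      intro h2
      rw [h2, zero_mul] at h
      exact (div_ne_zero hpi h0) h.symm
    rw [eq_div_iff h0] at h
    rw [div_eq_iff h1, ← mul_div_assoc, div_mul_eq_mul_div, eq_div_iff hpi]
    linear_combination -h

theorem wright_eq_s19 {α β x : ℝ} (hα0 : 0 < α) (hα1 : α < 1) (hβ : β < 1) (hx : 0 ≤ x) {θ : ℝ}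
    (hθ : θ = Real.pi * α / (1 + α)) (hθ2 : |θ| < Real.pi / 2) :
    (wright (-α) β (-x) : ℂ) =
      (Complex.exp ((Real.pi * β + θ * (1 - β)) * Complex.I) * Hfun α β θ (-θ) x -
       Complex.exp (-((Real.pi * β + θ * (1 - β)) * Complex.I)) * Hfun α β (-θ) θ x) /
        (2 * Real.pi * Complex.I) := by
  have hθ3 : θ * (1 + α) = Real.pi * α := by rw [hθ]; field_simp
  have hθc : (θ:ℂ) * (1 + α) = Real.pi * α := by exact_mod_cast hθ3
  have h1 := (Hfun_hasSum (ψ := -θ) hα0 hα1 hβ hθ2 hx).mul_left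
    (Complex.exp ((Real.pi * β + θ * (1 - β)) * Complex.I))
  have h2 := (Hfun_hasSum (φ := -θ) (ψ := θ) hα0 hα1 hβ (by rwa [abs_neg]) hx).mul_left
    (Complex.exp (-((Real.pi * β + θ * (1 - β)) * Complex.I)))
  have h3 := (h1.sub h2).div_const (2 * Real.pi * Complex.I)
  rw [← h3.tsum_eq, wright, Complex.ofReal_tsum]
  congr 1
  funext l
  have hs : -α * l + β < 1 := by
    have : 0 ≤ α * l := by positivity
    linarith
  have hr := rgamma_eq hs
  have e1 : Complex.exp ((Real.pi * β + θ * (1 - β)) * Complex.I) * (Complex.exp ((-θ : ℝ) * Complex.I * l) *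
      Complex.exp (-(θ * Complex.I * (1 - β + α * l)))) =
      Complex.exp (Real.pi * (-α * l + β : ℝ) * Complex.I) := by
    rw [← Complex.exp_add, ← Complex.exp_add]
    congr 1
    push_cast
    linear_combination -Complex.I * l * hθc
  have e2 : Complex.exp (-((Real.pi * β + θ * (1 - β)) * Complex.I)) * (Complex.exp (θ * Complex.I * l) *
      Complex.exp (-((-θ : ℝ) * Complex.I * (1 - β + α * l)))) =
      Complex.exp (-(Real.pi * (-α * l + β : ℝ) * Complex.I)) := by
    rw [← Complex.exp_add, ← Complex.exp_add]
    congr 1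
    push_cast
    linear_combination Complex.I * l * hθc
  have e3 : (((-x) ^ l / (l.factorial * Real.Gamma (-α * l + β)) : ℝ) : ℂ) =
      (-(x:ℂ)) ^ l / (l.factorial : ℂ) * (1 / (Real.Gamma (-α * l + β) : ℂ)) := by
    push_cast
    rw [div_mul_div_comm, mul_one]
  have e4 : (1 : ℂ) - (-α * l + β : ℝ) = 1 - β + α * l := by push_cast; ring
  rw [e3, hr, ← e1, ← e2, e4]
  ring

theorem wright_mellin {α β : ℝ} (hα0 : 0 < α) (hα1 : α < 1) (hβ0 : 0 < β) (hβ : β < 1) {p : ℂ}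
    (hp : 0 < p.re) (hp1 : 0 < 1 - β - α * p.re) :
    HasMellin (fun x => (wright (-α) β (-x) : ℂ)) p (Complex.Gamma p / Complex.Gamma (β + α * p)) := by
  obtain ⟨θ, hθ⟩ : ∃ θ, θ = Real.pi * α / (1 + α) := ⟨_, rfl⟩
  have hpi := Real.pi_pos
  have hθ3 : θ * (1 + α) = Real.pi * α := by rw [hθ]; field_simp
  have hθc : (θ:ℂ) * (1 + α) = Real.pi * α := by exact_mod_cast hθ3
  have hθ0 : 0 < θ := by rw [hθ]; positivity
  have hθ2 : |θ| < Real.pi / 2 := by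
    rw [abs_of_pos hθ0, hθ, div_lt_div_iff₀ (by linarith) two_pos]
    nlinarith
  have hθ2' : |-θ| < Real.pi / 2 := by rwa [abs_neg]
  have m1 := Hfun_mellin (α := α) (β := β) hθ2 hθ2' hp hp1
  have m2 := Hfun_mellin (α := α) (β := β) hθ2' hθ2 hp hp1
  set A : ℂ := Complex.exp ((Real.pi * β + θ * (1 - β)) * Complex.I) with hA
  set B : ℂ := Complex.exp (-((Real.pi * β + θ * (1 - β)) * Complex.I)) with hB
  have m3 := hasMellin_sub (m1.1.const_smul A) (m2.1.const_smul B)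
  rw [mellin_const_smul, mellin_const_smul, m1.2, m2.2] at m3
  have hcongr : ∀ x ∈ Ioi (0:ℝ), (wright (-α) β (-x) : ℂ) =
      (A • Hfun α β θ (-θ) x - B • Hfun α β (-θ) θ x) / (2 * Real.pi * Complex.I) := by
    intro x hx
    exact wright_eq_s19 hα0 hα1 hβ (le_of_lt hx) hθ hθ2
  refine ⟨?_, ?_⟩
  · have := m3.1.div_const (2 * Real.pi * Complex.I)
    refine IntegrableOn.congr_fun this (fun x hx => ?_) measurableSet_Ioi
    simp only
    rw [hcongr x hx]
  · have : mellin (fun x => (wright (-α) β (-x) : ℂ)) p = mellin (fun x =>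
      (A • Hfun α β θ (-θ) x - B • Hfun α β (-θ) θ x) / (2 * Real.pi * Complex.I)) p := by
      refine setIntegral_congr_fun measurableSet_Ioi (fun x hx => ?_)
      simp only
      rw [hcongr x hx]
    rw [this, mellin_div_const, m3.2]
    have e1 : A * (Complex.exp (-((-θ : ℝ) * Complex.I * p)) * Complex.exp (-(θ * Complex.I * (1 - β - α * p)))) =
        Complex.exp (Real.pi * (β + α * p) * Complex.I) := by
      rw [hA, ← Complex.exp_add, ← Complex.exp_add]
      congr 1
      push_cast
      linear_combination Complex.I * p * hθc
    have e2 : B * (Complex.exp (-(θ * Complex.I * p)) * Complex.exp (-((-θ : ℝ) * Complex.I * (1 - β - α * p)))) =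
        Complex.exp (-(Real.pi * (β + α * p) * Complex.I)) := by
      rw [hB, ← Complex.exp_add, ← Complex.exp_add]
      congr 1
      push_cast
      linear_combination -Complex.I * p * hθc
    have hg : Complex.Gamma (β + α * p) ≠ 0 := by
      apply Complex.Gamma_ne_zero_of_re_pos
      simp
      positivity
    have hg1 : Complex.Gamma (1 - (β + α * p)) ≠ 0 := by
      apply Complex.Gamma_ne_zero_of_re_pos
      simp
      linarith
    have h := Complex.Gamma_mul_Gamma_one_sub (β + α * p)
    have hsin : Complex.sin (Real.pi * (β + α * p)) ≠ 0 := by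
      intro h0
      rw [h0, div_zero] at h
      exact mul_ne_zero hg hg1 h
    have hpi0 : (Real.pi : ℂ) ≠ 0 := by exact_mod_cast hpi.ne'
    rw [eq_div_iff hsin] at h
    have e5 : (1:ℂ) - β - α * p = 1 - (β + α * p) := by ring
    have hs : Complex.exp (Real.pi * (β + α * p) * Complex.I) - Complex.exp (-(Real.pi * (β + α * p) * Complex.I)) = 2 * Complex.I * Complex.sin (Real.pi * (β + α * p)) := by
      rw [Complex.sin]
      ring_nf
      rw [Complex.I_sq]
      ring
    simp only [smul_eq_mul]
    rw [← mul_assoc A, ← mul_assoc B, e1, e2, ← sub_mul, hs, e5]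
    rw [div_eq_div_iff (by simp [hpi0]) hg]
    linear_combination 2 * Complex.I * Complex.Gamma p * h

noncomputable def fden (α t : ℝ) : ℝ :=
  (2 : ℝ) ^ ((α + 1) / 2) * wright (-α) ((1 - α) / 2) (-((2 : ℝ) ^ (α - 1) * t ^ 2))

theorem fden_mellin {α : ℝ} (hα0 : 0 < α) (hα1 : α < 1) (τ : ℝ) :
    HasMellin (fun t => (fden α t : ℂ)) (1 + τ * Complex.I)
      ((2:ℂ) ^ ((1 - α) / 2 * (τ * Complex.I)) * (Complex.Gamma ((1 + τ * Complex.I) / 2) /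
        Complex.Gamma ((1 + (α * τ : ℝ) * Complex.I) / 2))) := by
  set s : ℂ := 1 + τ * Complex.I with hs
  have hsre : (s / 2).re = 1 / 2 := by
    rw [hs]; simp
  set c : ℝ := (2 : ℝ) ^ (α - 1) with hc
  have hc0 : 0 < c := by positivity
  have m := wright_mellin (p := s / 2) hα0 hα1 (β := (1 - α) / 2) (by linarith) (by linarith)
    (by rw [hsre]; norm_num) (by rw [hsre]; linarith)
  set g : ℝ → ℂ := fun x => (wright (-α) ((1 - α) / 2) (-x) : ℂ) with hg
  have heq : (fun t => (fden α t : ℂ)) = fun t : ℝ => ((2:ℝ) ^ ((α + 1) / 2) : ℝ) •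
      (fun y => g (c * y)) (t ^ (2:ℝ)) := by
    funext t
    simp only [fden, hg, ← hc, Complex.real_smul, Complex.ofReal_mul, Real.rpow_two]
  have s2 : s / ((2:ℝ):ℂ) = s / 2 := by norm_num
  have mc : MellinConvergent (fun t : ℝ => (fun y => g (c * y)) (t ^ (2:ℝ))) s := by
    rw [MellinConvergent.comp_rpow (f := fun y => g (c * y)) two_ne_zero, s2,
      MellinConvergent.comp_mul_left hc0]
    exact m.1
  refine ⟨?_, ?_⟩
  · rw [heq]
    exact mc.const_smul _
  · rw [heq, mellin_const_smul, mellin_comp_rpow (fun y => g (c * y)), s2, mellin_comp_mul_left _ _ hc0, m.2]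
    have e1 : (((1 - α) / 2 : ℝ) : ℂ) + α * (s / 2) = (1 + (α * τ : ℝ) * Complex.I) / 2 := by
      rw [hs]; push_cast; ring
    rw [e1, Complex.real_smul, Complex.real_smul, smul_eq_mul, ← mul_assoc, ← mul_assoc]
    congr 1
    have h2 : (2:ℂ) ≠ 0 := two_ne_zero
    have e2 : (c : ℂ) ^ (-(s/2)) = (2:ℂ) ^ ((α - 1) * (-(s / 2))) := by
      have h := Complex.cpow_mul_ofReal_nonneg two_pos.le (α - 1) (-(s / 2))
      rw [Complex.ofReal_sub, Complex.ofReal_one, Complex.ofReal_ofNat] at h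
      rw [hc, h]
    have e3 : (((2:ℝ) ^ ((α + 1) / 2) : ℝ) : ℂ) = (2:ℂ) ^ (((α:ℂ) + 1) / 2) := by
      rw [Complex.ofReal_cpow two_pos.le]; push_cast; rfl
    have e4 : ((|(2:ℝ)|⁻¹ : ℝ) : ℂ) = (2:ℂ) ^ (-1 : ℂ) := by
      rw [Complex.cpow_neg_one]; simp
    rw [e2, e3, e4, ← Complex.cpow_add _ _ h2, ← Complex.cpow_add _ _ h2, hs]
    ring_nf

theorem exp_log_cpow {t : ℝ} (ht : 0 < t) (τ : ℝ) :
    Complex.exp (τ * (Real.log t : ℝ) * Complex.I) = (t:ℂ) ^ ((1 + τ * Complex.I) - 1) := by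
  rw [Complex.cpow_def_of_ne_zero (by exact_mod_cast ht.ne'), ← Complex.ofReal_log ht.le]
  ring_nf

theorem fden_nonneg {α : ℝ} (hα0 : 0 < α) (hα1 : α < 1)
    (h : ∫⁻ t in Ioi (0:ℝ), ENNReal.ofReal (fden α t) = 1) :
    IntegrableOn (fden α) (Ioi 0) ∧ ∀ᵐ t ∂(volume.restrict (Ioi (0:ℝ))), 0 ≤ fden α t := by
  have m := fden_mellin hα0 hα1 0
  have hi : IntegrableOn (fun t => (fden α t : ℂ)) (Ioi 0) := by
    have := m.1
    simpa [MellinConvergent] using this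
  have hi' : IntegrableOn (fden α) (Ioi 0) := by
    have := hi.re
    simp only [RCLike.re_to_complex, Complex.ofReal_re] at this
    exact this
  refine ⟨hi', ?_⟩
  have hv : ∫ t in Ioi (0:ℝ), fden α t = 1 := by
    have h2 := m.2
    have hg : Complex.Gamma (1 / 2) ≠ 0 := by
      apply Complex.Gamma_ne_zero_of_re_pos
      norm_num
    simp only [mellin, Complex.ofReal_zero, zero_mul, add_zero, sub_self, Complex.cpow_zero, one_smul,
      mul_zero, one_mul, div_self hg] at h2
    rw [integral_complex_ofReal] at h2
    exact_mod_cast h2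
  rw [integral_eq_lintegral_pos_part_sub_lintegral_neg_part hi', h] at hv
  have hneg : ∫⁻ t in Ioi (0:ℝ), ENNReal.ofReal (-fden α t) = 0 := by
    have hfin : ∫⁻ t in Ioi (0:ℝ), ENNReal.ofReal (-fden α t) ≠ ⊤ :=
      (hi'.neg.lintegral_lt_top).ne
    have : (∫⁻ t in Ioi (0:ℝ), ENNReal.ofReal (-fden α t)).toReal = 0 := by
      simpa using hv
    exact ((ENNReal.toReal_eq_zero_iff _).1 this).resolve_right hfin
  replace hneg := (lintegral_eq_zero_iff' (hi'.neg.aemeasurable.ennreal_ofReal)).1 hneg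
  filter_upwards [hneg] with t ht
  simpa using ht

theorem charFun_logX {α : ℝ} (hα0 : 0 < α) (hα1 : α < 1) (m : Measure ℝ) [IsProbabilityMeasure m]
    (hm : m = (volume.restrict (Ioi (0 : ℝ))).withDensity (fun t => ENNReal.ofReal (fden α t)))
    (τ : ℝ) :
    charFun (m.map Real.log) τ = (2:ℂ) ^ ((1 - α) / 2 * (τ * Complex.I)) *
      (Complex.Gamma ((1 + τ * Complex.I) / 2) /
        Complex.Gamma ((1 + (α * τ : ℝ) * Complex.I) / 2)) := by
  have h1 : ∫⁻ t in Ioi (0:ℝ), ENNReal.ofReal (fden α t) = 1 := by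
    have : m univ = 1 := measure_univ
    rw [hm, withDensity_apply _ MeasurableSet.univ, Measure.restrict_univ] at this
    exact this
  obtain ⟨hi, hpos⟩ := fden_nonneg hα0 hα1 h1
  rw [charFun_apply_real, integral_map Real.measurable_log.aemeasurable
    (Measurable.aestronglyMeasurable (by fun_prop)), hm,
    integral_withDensity_eq_integral_toReal_smul₀ (hi.aemeasurable.ennreal_ofReal)
      (Eventually.of_forall fun x => ENNReal.ofReal_lt_top)]
  rw [← (fden_mellin hα0 hα1 τ).2]
  refine integral_congr_ae ?_
  filter_upwards [hpos, ae_restrict_mem measurableSet_Ioi] with t ht ht0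
  rw [ENNReal.toReal_ofReal ht, exp_log_cpow ht0, Complex.real_smul, smul_eq_mul, mul_comm]

theorem charFun_logN (τ : ℝ) :
    charFun ((gaussianReal 0 1).map (fun x => Real.log |x|)) τ =
      ((Real.sqrt (2 * Real.pi))⁻¹ : ℝ) * ((2:ℂ) ^ ((1 + τ * Complex.I) / 2) *
        Complex.Gamma ((1 + τ * Complex.I) / 2)) := by
  rw [charFun_apply_real, integral_map (Measurable.aemeasurable (by fun_prop))
    (Measurable.aestronglyMeasurable (by fun_prop)),
    integral_gaussianReal_eq_integral_smul one_ne_zero]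
  set h : ℝ → ℂ := fun x => gaussianPDFReal 0 1 x • Complex.exp (τ * (Real.log |x| : ℝ) * Complex.I) with hh
  have hint : Integrable h := by
    refine Integrable.mono' (integrable_gaussianPDFReal 0 1)
      (Measurable.aestronglyMeasurable (by fun_prop)) (Eventually.of_forall fun x => ?_)
    rw [hh]
    simp only
    rw [norm_smul, ← Complex.ofReal_mul, Complex.norm_exp_ofReal_mul_I, mul_one,
      Real.norm_of_nonneg (gaussianPDFReal_nonneg 0 1 x)]
  have heven : ∀ x, h (-x) = h x := by
    intro x
    simp [hh, gaussianPDFReal]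
  have hsplit : ∫ x, h x = 2 * ∫ x in Ioi (0:ℝ), h x := by
    rw [← integral_add_compl (s := Ioi (0:ℝ)) measurableSet_Ioi hint, compl_Ioi]
    have : ∫ x in Iic (0:ℝ), h x = ∫ x in Ioi (0:ℝ), h x := by
      have := integral_comp_neg_Iic (0:ℝ) h
      simp only [heven, neg_zero] at this
      exact this
    rw [this]; ring
  rw [hsplit]
  set s : ℂ := 1 + τ * Complex.I with hs
  have hsre : (s / 2).re = 1 / 2 := by
    rw [hs]; simp
  have e : ∫ x in Ioi (0:ℝ), h x = ((Real.sqrt (2 * Real.pi))⁻¹ : ℝ) *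
      mellin (fun t : ℝ => (fun y : ℝ => Complex.exp (-(((1 / 2 : ℝ) : ℂ) * y))) (t ^ (2:ℝ))) s := by
    rw [mellin, ← integral_const_mul]
    refine setIntegral_congr_fun measurableSet_Ioi fun x hx => ?_
    have hx : 0 < x := hx
    simp only [hh]
    rw [abs_of_pos hx, exp_log_cpow hx, gaussianPDFReal, Complex.real_smul, smul_eq_mul, Complex.ofReal_mul]
    have : ((Real.exp (-(x - 0) ^ 2 / (2 * ((1:NNReal):ℝ))) : ℝ) : ℂ) =
        Complex.exp (-(((1 / 2 : ℝ) : ℂ) * ((x ^ (2:ℝ) : ℝ) : ℂ))) := by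
      rw [Complex.ofReal_exp, Real.rpow_two]
      congr 1
      push_cast
      simp
      ring
    rw [this]
    simp only [NNReal.coe_one, mul_one, ← hs]
    ring
  have s2 : s / ((2:ℝ):ℂ) = s / 2 := by norm_num
  rw [e, mellin_comp_rpow (fun y : ℝ => Complex.exp (-(((1 / 2 : ℝ) : ℂ) * y))), s2, mellin]
  simp only [smul_eq_mul]
  rw [Complex.integral_cpow_mul_exp_neg_mul_Ioi (by rw [hsre]; norm_num) (by norm_num)]
  have : (1 / ((1 / 2 : ℝ) : ℂ)) = 2 := by push_cast; norm_num
  rw [this, Complex.real_smul]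
  simp
  ring

theorem uniq_iter {α : ℝ} (hα0 : 0 < α) (hα1 : α < 1) {f g k : ℝ → ℂ} (hf : Continuous f)
    (hg : Continuous g) (h0 : f 0 = g 0) (hk : ∀ t, ‖k t‖ ≤ 1)
    (h1 : ∀ t, f t = f (α * t) * k t) (h2 : ∀ t, g t = g (α * t) * k t) : f = g := by
  funext t
  have hn : ∀ n : ℕ, ‖f t - g t‖ ≤ ‖f (α ^ n * t) - g (α ^ n * t)‖ := by
    intro n
    induction n with
    | zero => simp
    | succ n ih =>
      refine ih.trans ?_
      rw [h1 (α ^ n * t), h2 (α ^ n * t), ← sub_mul, norm_mul, pow_succ', mul_assoc]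
      exact mul_le_of_le_one_right (norm_nonneg _) (hk _)
  have hlim : Tendsto (fun n : ℕ => ‖f (α ^ n * t) - g (α ^ n * t)‖) atTop (nhds 0) := by
    have hc : Continuous fun u => ‖f u - g u‖ := (hf.sub hg).norm
    have ht : Tendsto (fun n : ℕ => α ^ n * t) atTop (nhds 0) := by
      simpa using (tendsto_pow_atTop_nhds_zero_of_lt_one hα0.le hα1).mul_const t
    have := (hc.tendsto 0).comp ht
    simpa [h0, Function.comp_def] using this
  have : ‖f t - g t‖ ≤ 0 := ge_of_tendsto' hlim hn
  exact sub_eq_zero.1 (norm_le_zero_iff.1 this)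

theorem symm_ext {m n : Measure ℝ} (hm : m.map (fun x => -x) = m) (hn : n.map (fun x => -x) = n)
    (h : m.map (fun x => |x|) = n.map (fun x => |x|)) : m = n := by
  have key : ∀ (m : Measure ℝ), m.map (fun x => -x) = m → ∀ A, MeasurableSet A →
      2 * m A = ∫⁻ y, (A.indicator 1 y + A.indicator 1 (-y)) ∂(m.map (fun x => |x|)) := by
    intro m hm A hA
    have hi : Measurable (A.indicator (1 : ℝ → ENNReal)) := measurable_one.indicator hA
    rw [lintegral_map (by fun_prop) (by fun_prop)]
    have e1 : ∀ x : ℝ, A.indicator (1 : ℝ → ENNReal) |x| + A.indicator 1 (-|x|) =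
        A.indicator 1 x + A.indicator 1 (-x) := by
      intro x
      rcases abs_choice x with h | h <;> rw [h]
      rw [neg_neg, add_comm]
    simp only [e1]
    rw [lintegral_add_left hi, lintegral_indicator_one hA]
    have e2 : ∫⁻ x, A.indicator 1 (-x) ∂m = m A := by
      rw [← lintegral_map (f := A.indicator 1) (g := fun x : ℝ => -x) hi measurable_neg, hm, lintegral_indicator_one hA]
    rw [e2, two_mul]
  ext A hA
  have h1 := key m hm A hA
  have h2 := key n hn A hA
  rw [h, ← h2] at h1
  exact (ENNReal.mul_right_inj two_ne_zero ENNReal.ofNat_ne_top).1 h1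

theorem gaussian_characterization
    {Ω : Type*} [MeasurableSpace Ω] (μ : Measure Ω) [IsProbabilityMeasure μ]
    (α : ℝ) (hα0 : 0 < α) (hα1 : α < 1)
    (U X : Ω → ℝ) (hU : Measurable U) (hX : Measurable X)
    (hindep : IndepFun U X μ)
    (hsymm : μ.map U = μ.map (fun ω => -U ω))
    (ρ : ℝ → ℝ) (hρcont : Continuous ρ)
    (hlawU : μ.map U = volume.withDensity (fun x => ENNReal.ofReal (ρ x)))
    (hMellin : ∀ s : ℂ, 0 < s.re →
      IntegrableOn (fun t : ℝ => (t : ℂ) ^ (s - 1) * ((ρ t + ρ (-t) : ℝ) : ℂ)) (Ioi 0))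
    (hlawX : μ.map X =
      (volume.restrict (Ioi (0 : ℝ))).withDensity
        (fun t => ENNReal.ofReal
          ((2 : ℝ) ^ ((α + 1) / 2) *
            wright (-α) ((1 - α) / 2) (-((2 : ℝ) ^ (α - 1) * t ^ 2)))))
    (hdecomp : μ.map (fun ω => |U ω|) = μ.map (fun ω => |U ω| ^ α * X ω)) :
    μ.map U = gaussianReal 0 1 := by
  have hf : (fun t : ℝ => ENNReal.ofReal
          ((2 : ℝ) ^ ((α + 1) / 2) *
            wright (-α) ((1 - α) / 2) (-((2 : ℝ) ^ (α - 1) * t ^ 2)))) =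
      fun t => ENNReal.ofReal (fden α t) := rfl
  rw [hf] at hlawX
  have hpX : IsProbabilityMeasure (μ.map X) := Measure.isProbabilityMeasure_map hX.aemeasurable
  have hpU : IsProbabilityMeasure (μ.map U) := Measure.isProbabilityMeasure_map hU.aemeasurable
  have hXpos : ∀ᵐ ω ∂μ, 0 < X ω := by
    refine ae_of_ae_map (p := fun x => 0 < x) hX.aemeasurable ?_
    rw [hlawX]
    exact (withDensity_absolutelyContinuous _ _).ae_le (ae_restrict_mem measurableSet_Ioi)
  have hU0' : ∀ᵐ x ∂(μ.map U), x ≠ 0 := by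
    rw [hlawU]
    exact (withDensity_absolutelyContinuous _ _).ae_le (Measure.ae_ne volume 0)
  have hU0 : ∀ᵐ ω ∂μ, U ω ≠ 0 := ae_of_ae_map (p := fun x => x ≠ 0) hU.aemeasurable hU0'
  have hN0 : ∀ᵐ x ∂(gaussianReal 0 1), x ≠ 0 :=
    (gaussianReal_absolutelyContinuous 0 one_ne_zero).ae_le (Measure.ae_ne volume 0)
  have hmlog : Measurable (fun x : ℝ => Real.log |x|) := by fun_prop
  -- the functional equation of the law of log |U|
  have hlaw : (μ.map U).map (fun x => Real.log |x|) =
      μ.map ((fun ω => α * Real.log |U ω|) + (fun ω => Real.log (X ω))) := by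
    have h1 := congrArg (fun m => Measure.map Real.log m) hdecomp
    rw [Measure.map_map Real.measurable_log (by fun_prop),
      Measure.map_map Real.measurable_log (by fun_prop)] at h1
    rw [Measure.map_map hmlog hU]
    refine h1.trans (Measure.map_congr ?_)
    filter_upwards [hXpos, hU0] with ω h2 h3
    have h4 : 0 < |U ω| := abs_pos.2 h3
    simp only [Function.comp_apply, Pi.add_apply]
    rw [Real.log_mul (Real.rpow_pos_of_pos h4 _).ne' h2.ne', Real.log_rpow h4]
  have hind : IndepFun (fun ω => α * Real.log |U ω|) (fun ω => Real.log (X ω)) μ :=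
    hindep.comp (φ := fun x => α * Real.log |x|) (ψ := Real.log) (by fun_prop) Real.measurable_log
  have hchU : ∀ t, charFun ((μ.map U).map (fun x => Real.log |x|)) t =
      charFun ((μ.map U).map (fun x => Real.log |x|)) (α * t) *
        charFun ((μ.map X).map Real.log) t := by
    intro t
    have h1 := congrFun (hind.charFun_map_add_eq_mul (by fun_prop) (by fun_prop)) t
    rw [← hlaw, Pi.mul_apply] at h1
    rw [h1, Measure.map_map Real.measurable_log hX]
    congr 1
    rw [charFun_apply_real, charFun_apply_real,
      integral_map (by fun_prop) (Measurable.aestronglyMeasurable (by fun_prop)),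
      Measure.map_map hmlog hU,
      integral_map (by fun_prop) (Measurable.aestronglyMeasurable (by fun_prop))]
    refine integral_congr_ae (Eventually.of_forall fun ω => ?_)
    simp only [Function.comp_apply]
    congr 1
    push_cast
    ring
  have hchN : ∀ t, charFun ((gaussianReal 0 1).map (fun x => Real.log |x|)) t =
      charFun ((gaussianReal 0 1).map (fun x => Real.log |x|)) (α * t) *
        charFun ((μ.map X).map Real.log) t := by
    intro t
    rw [charFun_logN, charFun_logN, charFun_logX hα0 hα1 _ hlawX]
    have hg : Complex.Gamma ((1 + (α * t : ℝ) * Complex.I) / 2) ≠ 0 := by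
      apply Complex.Gamma_ne_zero_of_re_pos
      simp
    have e : (2:ℂ) ^ ((1 + t * Complex.I) / 2) = (2:ℂ) ^ ((1 + (α * t : ℝ) * Complex.I) / 2) *
        (2:ℂ) ^ ((1 - α) / 2 * (t * Complex.I)) := by
      rw [← Complex.cpow_add _ _ two_ne_zero]
      congr 1
      push_cast
      ring
    rw [e]
    field_simp
  have hp1 : IsProbabilityMeasure ((μ.map U).map (fun x => Real.log |x|)) :=
    Measure.isProbabilityMeasure_map hmlog.aemeasurable
  have hp2 : IsProbabilityMeasure ((gaussianReal 0 1).map (fun x => Real.log |x|)) :=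
    Measure.isProbabilityMeasure_map hmlog.aemeasurable
  have hp3 : IsProbabilityMeasure ((μ.map X).map Real.log) :=
    Measure.isProbabilityMeasure_map Real.measurable_log.aemeasurable
  have hlogeq : (μ.map U).map (fun x => Real.log |x|) =
      (gaussianReal 0 1).map (fun x => Real.log |x|) := by
    refine Measure.ext_of_charFun ?_
    refine uniq_iter hα0 hα1 continuous_charFun continuous_charFun ?_ ?_ hchU hchN
    · rw [charFun_zero, charFun_zero, probReal_univ, probReal_univ]
    · intro t
      exact norm_charFun_le_one t
  have habs : ∀ m : Measure ℝ, (∀ᵐ x ∂m, x ≠ 0) →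
      m.map (fun x => |x|) = (m.map (fun x => Real.log |x|)).map Real.exp := by
    intro m hm
    rw [Measure.map_map Real.measurable_exp hmlog]
    refine Measure.map_congr ?_
    filter_upwards [hm] with x hx
    simp only [Function.comp_apply]
    rw [Real.exp_log (abs_pos.2 hx)]
  refine symm_ext ?_ ?_ ?_
  · rw [Measure.map_map measurable_neg hU]
    exact hsymm.symm
  · rw [gaussianReal_map_neg, neg_zero]
  · rw [habs _ hU0', habs _ hN0, hlogeq]
end
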